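/- For every ε > 0 there is a constant A_ε such that for every odd prime q and every real number B with 1 ≤ B < q, one has (1/φ(q)) Σ_{k=0}^{q−1} |C(k) + C Σ_{n ≤ B} b(n) ψ(k·m(n)/q)|² ≤ A_ε · B^{−1+ε}, where m(n) denotes the multiplicative inverse of 2n mod q. -/

import Mathlib

open scoped Classical Real
open Complex MeasureTheory

/-- The sawtooth function `ψ`. -/
noncomputable def saw (x : ℝ) : ℝ := if Int.fract x = 0 then 0 else Int.fract x - 1/2

/-- The Euler product `A_{q,χ}`. -/
noncomputable def Aq (q : ℕ) (χ : DirichletCharacter ℂ q) : ℂ :=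
  ∏' p : Nat.Primes, if (p : ℕ) ∣ q then 1 else
    1 - (1 - χ ((p : ℕ) : ZMod q)) ^ 2 / (((p : ℕ) : ℂ) - 1) ^ 2

/-- The quantity `C(k) = C(k; q)` (a real number; we take the real part of the
defining expression, which is real). -/
noncomputable def Cfun (q : ℕ) (k : ℤ) : ℝ :=
  if h : q = 0 then 0 else
    haveI : NeZero q := ⟨h⟩
    ((↑q.totient : ℂ)⁻¹ *
      ∑ χ ∈ Finset.univ.filter (fun χ : DirichletCharacter ℂ q => χ ≠ 1),
        (starRingEnd ℂ) (χ ((k : ZMod q))) * DirichletCharacter.LFunction χ 0 *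
          DirichletCharacter.LFunction χ 1 * Aq q χ).re

/-- The multiplicative function `a(n)`: `a(2) = -1/2`, `a(2^v) = 0` for `v ≥ 2`, and for odd
primes `p`, `a(p) = 2/(p(p-2))`, `a(p²) = -1/(p(p-2))`, `a(p^v) = 0` for `v ≥ 3`. -/
noncomputable def aCoef (n : ℕ) : ℝ :=
  if n = 0 then 0 else
    ∏ p ∈ n.primeFactors,
      if p = 2 then (if n.factorization 2 = 1 then (-1/2 : ℝ) else 0)
      else (if n.factorization p = 1 then 2 / (p * (p - 2) : ℝ)
            else if n.factorization p = 2 then -1 / (p * (p - 2) : ℝ) else 0)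

/-- `b(n) = ∑_{uv = n} a(u)/v`. -/
noncomputable def bCoef (n : ℕ) : ℝ := ∑ u ∈ n.divisors, aCoef u / ((n / u : ℕ) : ℝ)

/-- The constant `C = C_q = 2 ∏_{p odd prime, p ∤ q} (1 - 1/(p-1)²)`. -/
noncomputable def Cq (q : ℕ) : ℝ :=
  2 * ∏' p : Nat.Primes, if (p : ℕ) = 2 ∨ (p : ℕ) ∣ q then 1
    else 1 - 1 / ((p : ℝ) - 1) ^ 2

/-- The least nonnegative residue of the multiplicative inverse of `n` mod `q`. -/
noncomputable def invMod (q n : ℕ) : ℕ := ZMod.val ((n : ZMod q)⁻¹)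

/-- Dirichlet's test at `s = 1`, for a function continuing an `L`-series with bounded partial
sums. -/
theorem norm_sub_sum_div_le_of_partialSums_bounded {f : ℕ → ℂ} {F : ℂ → ℂ} {K : ℝ}
    (hK : ∀ n : ℕ, ‖∑ k ∈ Finset.Icc 1 n, f k‖ ≤ K)
    (hs : ∀ s : ℝ, 1 < s → LSeriesSummable f s)
    (hF : ∀ s : ℝ, 1 < s → F s = LSeries f s) (hc : ContinuousAt F 1) {N : ℕ} (hN : 1 ≤ N) :
    ‖F 1 - ∑ n ∈ Finset.Icc 1 N, f n / n‖ ≤ 2 * K / N := by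
  have hN0 : (0 : ℝ) < N := by exact_mod_cast hN
  have hK0 : 0 ≤ K := (norm_nonneg _).trans (hK 0)
  set g : ℕ → ℂ := fun n => if n ≤ N then 0 else f n with hg
  have hgsum : ∀ n : ℕ, ‖∑ k ∈ Finset.Icc 1 n, g k‖ ≤ 2 * K := by
    intro n
    rcases le_total n N with h | h
    · rw [Finset.sum_eq_zero]
      · simpa using hK0
      · intro k hk
        rw [Finset.mem_Icc] at hk
        simp [hg, hk.2.trans h]
    · have h1 : ∑ k ∈ Finset.Icc 1 n, f k =
          ∑ k ∈ Finset.Icc 1 N, f k + ∑ k ∈ Finset.Icc 1 n, g k := by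
        have : ∑ k ∈ Finset.Icc 1 N, f k = ∑ k ∈ Finset.Icc 1 n, if k ≤ N then f k else 0 := by
          rw [← Finset.sum_filter]
          congr 1
          ext k
          simp only [Finset.mem_filter, Finset.mem_Icc]
          omega
        rw [this, ← Finset.sum_add_distrib]
        refine Finset.sum_congr rfl fun k _ => ?_
        by_cases hk : k ≤ N <;> simp [hg, hk]
      have h2 : ∑ k ∈ Finset.Icc 1 n, g k =
          ∑ k ∈ Finset.Icc 1 n, f k - ∑ k ∈ Finset.Icc 1 N, f k := by rw [h1]; ring
      rw [h2]
      linarith [norm_sub_le (∑ k ∈ Finset.Icc 1 n, f k) (∑ k ∈ Finset.Icc 1 N, f k), hK n, hK N]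
  have key : ∀ s : ℝ, 1 < s →
      ‖F s - ∑ n ∈ Finset.Icc 1 N, f n / (n : ℂ) ^ (s : ℂ)‖ ≤ 2 * K * (N : ℝ) ^ (-s) := by
    intro s h1
    have hfin : HasSum (LSeries.term (fun n => if n ≤ N then f n else 0) s)
        (∑ n ∈ Finset.Icc 1 N, f n / (n : ℂ) ^ (s : ℂ)) := by
      have : ∑ n ∈ Finset.Icc 1 N, f n / (n : ℂ) ^ (s : ℂ) = ∑ n ∈ Finset.Icc 1 N,
          LSeries.term (fun n => if n ≤ N then f n else 0) s n := by
        refine Finset.sum_congr rfl fun n hn => ?_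
        rw [Finset.mem_Icc] at hn
        rw [LSeries.term_of_ne_zero (by omega), if_pos hn.2]
      rw [this]
      refine hasSum_sum_of_ne_finset_zero fun n hn => ?_
      rcases eq_or_ne n 0 with rfl | h0
      · simp
      · rw [LSeries.term_of_ne_zero h0, if_neg, zero_div]
        simp only [Finset.mem_Icc] at hn
        omega
    have hgf : LSeries.term g s = fun n => LSeries.term f s n -
        LSeries.term (fun n => if n ≤ N then f n else 0) s n := by
      ext n
      rcases eq_or_ne n 0 with rfl | h0
      · simp
      · simp only [LSeries.term_of_ne_zero h0, hg]
        split_ifs <;> simp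
    have hgS : HasSum (LSeries.term g s)
        (F s - ∑ n ∈ Finset.Icc 1 N, f n / (n : ℂ) ^ (s : ℂ)) := by
      rw [hgf, hF s h1]
      exact ((hs s h1).hasSum).sub hfin
    have hint := LSeries_eq_mul_integral g (r := 0) le_rfl (s := (s : ℂ)) (by simp; linarith)
      hgS.summable (by
        simp only [Real.rpow_zero]
        exact Asymptotics.IsBigO.of_bound (2 * K) (Filter.Eventually.of_forall fun n => by
          simpa using hgsum n))
    rw [← hgS.tsum_eq]
    change ‖LSeries g s‖ ≤ _
    rw [hint, norm_mul]
    have hres : ∫ t in Set.Ioi (1 : ℝ), (∑ k ∈ Finset.Icc 1 ⌊t⌋₊, g k) * (t : ℂ) ^ (-((s : ℂ) + 1))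
        = ∫ t in Set.Ioi (N : ℝ), (∑ k ∈ Finset.Icc 1 ⌊t⌋₊, g k) * (t : ℂ) ^ (-((s : ℂ) + 1)) := by
      refine setIntegral_eq_of_subset_of_forall_sdiff_eq_zero measurableSet_Ioi
        (Set.Ioi_subset_Ioi (by exact_mod_cast hN)) fun t ht => ?_
      rw [Finset.sum_eq_zero, zero_mul]
      intro k hk
      rw [Finset.mem_Icc] at hk
      have htN : t ≤ N := by simpa using ht.2
      have : ⌊t⌋₊ ≤ N := by
        simpa using Nat.floor_le_floor htN
      simp [hg, hk.2.trans this]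
    rw [hres]
    have hb : ‖∫ t in Set.Ioi (N : ℝ), (∑ k ∈ Finset.Icc 1 ⌊t⌋₊, g k) *
        (t : ℂ) ^ (-((s : ℂ) + 1))‖ ≤ ∫ t in Set.Ioi (N : ℝ), 2 * K * t ^ (-(s + 1)) := by
      refine norm_integral_le_of_norm_le
        ((integrableOn_Ioi_rpow_of_lt (by linarith) hN0).const_mul _) ?_
      filter_upwards [ae_restrict_mem measurableSet_Ioi] with t ht
      have ht0 : 0 < t := hN0.trans ht
      rw [norm_mul, Complex.norm_cpow_eq_rpow_re_of_pos ht0]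
      have : (-((s : ℂ) + 1)).re = -(s + 1) := by simp
      rw [this]
      gcongr
      exact hgsum _
    rw [integral_const_mul, integral_Ioi_rpow_of_lt (by linarith) hN0] at hb
    have hns : ‖(s : ℂ)‖ = s := by
      rw [Complex.norm_real, Real.norm_of_nonneg (by linarith)]
    rw [hns]
    refine (mul_le_mul_of_nonneg_left hb (by linarith)).trans (le_of_eq ?_)
    have : -(s + 1) + 1 = -s := by ring
    rw [this]
    have : s ≠ 0 := by linarith
    field_simp
  have ht1 : Filter.Tendsto (fun s : ℝ => ‖F s - ∑ n ∈ Finset.Icc 1 N, f n / (n : ℂ) ^ (s : ℂ)‖)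
      (nhdsWithin 1 (Set.Ioi 1)) (nhds ‖F 1 - ∑ n ∈ Finset.Icc 1 N, f n / n‖) := by
    have hof : Filter.Tendsto (fun s : ℝ => (s : ℂ)) (nhdsWithin 1 (Set.Ioi 1)) (nhds 1) := by
      have := (Complex.continuous_ofReal.tendsto (1 : ℝ)).mono_left
        (nhdsWithin_le_nhds (s := Set.Ioi (1 : ℝ)))
      simpa using this
    refine (Filter.Tendsto.sub (hc.tendsto.comp hof) ?_).norm
    refine tendsto_finsetSum _ fun n hn => ?_
    rw [Finset.mem_Icc] at hn
    have hn0 : (n : ℂ) ≠ 0 := by exact_mod_cast (by omega : n ≠ 0)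
    have hpow : Filter.Tendsto (fun s : ℝ => (n : ℂ) ^ (s : ℂ)) (nhdsWithin 1 (Set.Ioi 1))
        (nhds ((n : ℂ) ^ (1 : ℂ))) := hof.const_cpow (Or.inl hn0)
    rw [Complex.cpow_one] at hpow
    exact Filter.Tendsto.div (tendsto_const_nhds (x := f n)) hpow hn0
  have ht2 : Filter.Tendsto (fun s : ℝ => 2 * K * (N : ℝ) ^ (-s))
      (nhdsWithin 1 (Set.Ioi 1)) (nhds (2 * K / N)) := by
    have : ContinuousAt (fun s : ℝ => 2 * K * (N : ℝ) ^ (-s)) 1 := by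
      refine continuousAt_const.mul ?_
      exact (Real.continuousAt_const_rpow hN0.ne').comp continuousAt_neg
    have h := this.tendsto.mono_left (nhdsWithin_le_nhds (s := Set.Ioi (1 : ℝ)))
    rwa [Real.rpow_neg_one, ← div_eq_mul_inv] at h
  refine le_of_tendsto_of_tendsto ht1 ht2 ?_
  filter_upwards [self_mem_nhdsWithin] with s hs1
  exact key s hs1

theorem log_one_sub_exp_two_pi_mul_I {x : ℝ} (h0 : 0 < x) (h1 : x < 1) :
    Complex.log (1 - cexp (2 * π * I * x)) = Real.log (2 * Real.sin (π * x)) + π * (x - 1 / 2) * I := by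
  have hsin : 0 < 2 * Real.sin (π * x) := by
    have := Real.sin_pos_of_pos_of_lt_pi (x := π * x) (by positivity) (by nlinarith [Real.pi_pos])
    linarith
  have : (1 - cexp (2 * π * I * x)) =
      cexp (Real.log (2 * Real.sin (π * x)) + π * (x - 1 / 2) * I) := by
    rw [Complex.exp_add, ← Complex.ofReal_exp, Real.exp_log hsin]
    push_cast
    rw [Complex.sin, show (π : ℂ) * (x - 1 / 2) * I = π * x * I + -(π / 2 * I) by ring,
      Complex.exp_add, Complex.exp_neg (π / 2 * I), Complex.exp_pi_div_two_mul_I,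
      show (2 * π * I * x : ℂ) = π * x * I + π * x * I by ring, Complex.exp_add,
      show (-(π * x) * I : ℂ) = -(π * x * I) by ring, Complex.exp_neg, Complex.inv_I]
    have hne := Complex.exp_ne_zero (π * x * I)
    field_simp
    linear_combination (1 - cexp (π * x * I) ^ 2) * (Complex.I_sq)
  rw [this, Complex.log_exp]
  · simp
    nlinarith [Real.pi_pos]
  · simp
    nlinarith [Real.pi_pos]

theorem exp_two_pi_mul_I_ne_one {x : ℝ} (h0 : 0 < x) (h1 : x < 1) :
    cexp (2 * π * I * x) ≠ 1 := by
  intro h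
  rw [Complex.exp_eq_one_iff] at h
  obtain ⟨n, hn⟩ := h
  have h2 : (2 * π * I : ℂ) ≠ 0 := Complex.two_pi_I_ne_zero
  have h3 : (x : ℂ) = n := by
    have : (2 * π * I : ℂ) * x = (2 * π * I) * n := by rw [hn]; ring
    exact mul_left_cancel₀ h2 this
  have h4 : x = n := by exact_mod_cast h3
  rw [h4] at h0 h1
  have h5 : 0 < n := by exact_mod_cast h0
  have h6 : n < 1 := by exact_mod_cast h1
  omega

theorem unitAddCircle_coe_ne_zero {x : ℝ} (h0 : 0 < x) (h1 : x < 1) : (x : UnitAddCircle) ≠ 0 := by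
  intro h
  rw [AddCircle.coe_eq_zero_iff_of_mem_Ico (by simpa using ⟨h0.le, h1⟩)] at h
  exact h0.ne' h

theorem expZeta_one {x : ℝ} (h0 : 0 < x) (h1 : x < 1) :
    HurwitzZeta.expZeta (x : UnitAddCircle) 1 = -Complex.log (1 - cexp (2 * π * I * x)) := by
  set z := cexp (2 * π * I * x) with hz
  have hz1 : z ≠ 1 := exp_two_pi_mul_I_ne_one h0 h1
  have hzn : ‖z‖ = 1 := by
    rw [hz, show (2 * π * I * x : ℂ) = ((2 * π * x : ℝ) : ℂ) * I by push_cast; ring]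
    exact Complex.norm_exp_ofReal_mul_I _
  have hpow : ∀ n : ℕ, cexp (2 * π * I * x * n) = z ^ n := by
    intro n
    rw [hz, ← Complex.exp_nat_mul]
    ring_nf
  have hfun : (fun n : ℕ => cexp (2 * π * I * x * n)) = fun n : ℕ => z ^ n := funext hpow
  have hne : (x : UnitAddCircle) ≠ 0 := unitAddCircle_coe_ne_zero h0 h1
  have hL : ∀ s : ℝ, 1 < s → LSeriesHasSum (fun n : ℕ => z ^ n) s
      (HurwitzZeta.expZeta (x : UnitAddCircle) s) := by
    intro s hs
    have := HurwitzZeta.LSeriesHasSum_exp x (s := s) (by simpa using hs)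
    rwa [hfun] at this
  have hbd : ∀ n : ℕ, ‖∑ k ∈ Finset.Icc 1 n, z ^ k‖ ≤ 2 / ‖z - 1‖ := by
    intro n
    have : ∑ k ∈ Finset.Icc 1 n, z ^ k = z * ((z ^ n - 1) / (z - 1)) := by
      have h := Finset.sum_Ico_add' (fun k => z ^ k) 0 n 1
      rw [← geom_sum_eq hz1, Finset.mul_sum, Finset.range_eq_Ico]
      refine Eq.trans h.symm (Finset.sum_congr rfl fun k _ => by ring)
    rw [this, norm_mul, hzn, one_mul, norm_div]
    gcongr
    refine (norm_sub_le _ _).trans ?_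
    rw [norm_pow, hzn]
    norm_num
  have hlim : Filter.Tendsto (fun n : ℕ => ∑ i ∈ Finset.range n, z ^ i / (i : ℂ)) Filter.atTop
      (nhds (HurwitzZeta.expZeta (x : UnitAddCircle) 1)) := by
    rw [← Filter.tendsto_add_atTop_iff_nat 1]
    have hb : ∀ᶠ N : ℕ in Filter.atTop, ‖∑ i ∈ Finset.range (N + 1), z ^ i / (i : ℂ) -
        HurwitzZeta.expZeta (x : UnitAddCircle) 1‖ ≤ 2 * (2 / ‖z - 1‖) / N := by
      filter_upwards [Filter.eventually_ge_atTop 1] with N hN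
      have := norm_sub_sum_div_le_of_partialSums_bounded hbd
        (fun s hs => (hL s hs).LSeriesSummable) (fun s hs => (hL s hs).LSeries_eq.symm)
        (HurwitzZeta.differentiable_expZeta_of_ne_zero hne 1).continuousAt hN
      have hr : ∑ i ∈ Finset.range (N + 1), z ^ i / (i : ℂ) =
          ∑ n ∈ Finset.Icc 1 N, z ^ n / (n : ℂ) := by
        rw [Finset.range_eq_Ico, Finset.sum_eq_sum_Ico_succ_bot (by omega)]
        simp
        rfl
      rwa [norm_sub_rev, hr]
    rw [tendsto_iff_norm_sub_tendsto_zero]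
    exact squeeze_zero' (Filter.Eventually.of_forall fun _ => norm_nonneg _) hb
      (tendsto_const_div_atTop_nhds_zero_nat _)
  have hab := Complex.tendsto_tsum_powerSeries_nhdsWithin_lt hlim
  rw [Filter.tendsto_map'_iff] at hab
  have hlog : Filter.Tendsto ((fun w : ℂ => ∑' n : ℕ, z ^ n / (n : ℂ) * w ^ n) ∘ ((↑) : ℝ → ℂ))
      (nhdsWithin 1 (Set.Iio 1)) (nhds (-Complex.log (1 - z))) := by
    have hc : ContinuousAt (fun r : ℝ => -Complex.log (1 - z * r)) 1 := by
      refine ContinuousAt.neg (ContinuousAt.clog (by fun_prop) ?_)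
      left
      simp only [Complex.ofReal_one, mul_one, Complex.sub_re, Complex.one_re, sub_pos]
      refine lt_of_le_of_ne (hzn ▸ Complex.re_le_norm z) fun h => hz1 ?_
      have h2 := Complex.sq_norm_sub_sq_re z
      rw [hzn, h] at h2
      have him : z.im = 0 := by nlinarith
      exact Complex.ext h him
    have h3 := hc.tendsto.mono_left (nhdsWithin_le_nhds (s := Set.Iio (1 : ℝ)))
    simp only [Complex.ofReal_one, mul_one] at h3
    refine h3.congr' ?_
    filter_upwards [Ioo_mem_nhdsLT (show (0 : ℝ) < 1 by norm_num)] with r hr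
    have hr1 : ‖z * r‖ < 1 := by
      rw [norm_mul, hzn, one_mul, Complex.norm_real, Real.norm_of_nonneg hr.1.le]
      exact hr.2
    rw [Function.comp_apply, ← (Complex.hasSum_taylorSeries_neg_log hr1).tsum_eq]
    refine tsum_congr fun n => ?_
    rw [mul_pow]
    ring
  exact tendsto_nhds_unique hab hlog

theorem hurwitzZeta_apply_zero {x : ℝ} (h0 : 0 < x) (h1 : x < 1) :
    HurwitzZeta.hurwitzZeta (x : UnitAddCircle) 0 = 1 / 2 - x := by
  have hne : (x : UnitAddCircle) ≠ 0 := unitAddCircle_coe_ne_zero h0 h1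
  have h := HurwitzZeta.hurwitzZeta_one_sub (x : UnitAddCircle) (s := 1)
    (fun n hn => by
      have := congrArg Complex.re hn
      simp at this
      linarith [(Nat.cast_nonneg n : (0 : ℝ) ≤ n)]) (Or.inl hne)
  have hneg : -(x : UnitAddCircle) = ((1 - x : ℝ) : UnitAddCircle) := by
    rw [AddCircle.coe_sub, AddCircle.coe_period, zero_sub]
  rw [sub_self, hneg, expZeta_one h0 h1, expZeta_one (by linarith) (by linarith),
    log_one_sub_exp_two_pi_mul_I h0 h1, log_one_sub_exp_two_pi_mul_I (by linarith) (by linarith),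
    show π * (1 - x) = π - π * x by ring, Real.sin_pi_sub, mul_one, mul_one,
    show (-π * I / 2 : ℂ) = -(π / 2 * I) by ring, show (π * I / 2 : ℂ) = π / 2 * I by ring,
    Complex.exp_neg, Complex.exp_pi_div_two_mul_I, Complex.inv_I, Complex.cpow_neg_one,
    Complex.Gamma_one] at h
  rw [h]
  have hpi : (π : ℂ) ≠ 0 := by exact_mod_cast Real.pi_ne_zero
  push_cast
  field_simp
  linear_combination (2 * (2 * (x : ℂ) - 1) * π) * Complex.I_sq

section Characters

theorem dirichletCharacter_conj_apply {q : ℕ} [NeZero q] (χ : DirichletCharacter ℂ q)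
    (a : ZMod q) : (starRingEnd ℂ) (χ a) = χ⁻¹ a := by
  rw [← MulChar.star_apply', RCLike.star_def]

variable {q : ℕ} [Fact q.Prime]

theorem norm_gaussSum_sq {χ : DirichletCharacter ℂ q} (hχ : χ ≠ 1) :
    ‖gaussSum χ (ZMod.stdAddChar (N := q))‖ ^ 2 = q := by
  have h := gaussSum_mul_gaussSum_eq_card hχ (ZMod.isPrimitive_stdAddChar q)
  have hc : gaussSum χ⁻¹ (ZMod.stdAddChar (N := q))⁻¹ =
      (starRingEnd ℂ) (gaussSum χ (ZMod.stdAddChar (N := q))) := by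
    simp only [gaussSum, map_sum, map_mul]
    refine Finset.sum_congr rfl fun a _ => ?_
    rw [dirichletCharacter_conj_apply, AddChar.inv_apply, AddChar.map_neg_eq_conj]
  rw [hc, Complex.mul_conj, Complex.normSq_eq_norm_sq, ZMod.card] at h
  exact_mod_cast h

theorem dirichletCharacter_isPrimitive_of_ne_one {χ : DirichletCharacter ℂ q} (hχ : χ ≠ 1) :
    χ.IsPrimitive := by
  have hq : q.Prime := Fact.out
  rcases (Nat.dvd_prime hq).mp χ.conductor_dvd_level with h | h
  · exact absurd ((DirichletCharacter.eq_one_iff_conductor_eq_one).mpr h) hχ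
  · exact h

theorem norm_LFunction_zero_le {χ : DirichletCharacter ℂ q} (hχ : χ ≠ 1) :
    ‖DirichletCharacter.LFunction χ 0‖ ^ 2 ≤ q * ‖DirichletCharacter.LFunction χ⁻¹ 1‖ ^ 2 := by
  have hq : q.Prime := Fact.out
  have h0 : χ 0 = 0 := MulChar.map_zero χ
  have h := ZMod.LFunction_one_sub (fun a : ZMod q => χ a) (s := 1)
    (fun n hn => by
      have := congrArg Complex.re hn
      simp at this
      linarith [(Nat.cast_nonneg n : (0 : ℝ) ≤ n)]) (Or.inl h0)
  set τ := gaussSum χ (ZMod.stdAddChar (N := q)) with hτ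
  have hprim := dirichletCharacter_isPrimitive_of_ne_one hχ
  have hmul : ∀ (c : ℂ) (Φ : ZMod q → ℂ),
      ZMod.LFunction (fun a => c * Φ a) 1 = c * ZMod.LFunction Φ 1 := by
    intro c Φ
    simp only [ZMod.LFunction, Finset.mul_sum]
    exact Finset.sum_congr rfl fun a _ => by ring
  have hF : ∀ k : ZMod q, ZMod.dft (fun a : ZMod q => χ a) k = (χ⁻¹ (-1) * τ) * χ⁻¹ k := by
    intro k
    rw [hprim.fourierTransform_eq_inv_mul_gaussSum, ← neg_one_mul k, map_mul]
    ring
  have hF1 : ZMod.dft (fun a : ZMod q => χ a) = fun k => (χ⁻¹ (-1) * τ) * χ⁻¹ k := funext hF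
  have hF2 : ZMod.dft (fun a : ZMod q => χ (-a)) =
      fun k => (χ (-1) * (χ⁻¹ (-1) * τ)) * χ⁻¹ k := by
    have : (fun a : ZMod q => χ (-a)) = χ (-1) • (fun a : ZMod q => χ a) := by
      ext a
      rw [← neg_one_mul a, map_mul]
      rfl
    rw [this, map_smul, hF1]
    ext k
    simp only [Pi.smul_apply, smul_eq_mul]
    ring
  rw [hF1, hF2, hmul, hmul, sub_self, Complex.cpow_zero, Complex.Gamma_one, mul_one, mul_one,
    mul_one, one_mul, show (-π * I / 2 : ℂ) = -(π / 2 * I) by ring,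
    show (π * I / 2 : ℂ) = π / 2 * I by ring,
    Complex.exp_neg, Complex.exp_pi_div_two_mul_I, Complex.inv_I, Complex.cpow_neg_one] at h
  have hLdef : ∀ (ψ : DirichletCharacter ℂ q) (s : ℂ),
      DirichletCharacter.LFunction ψ s = ZMod.LFunction (fun a => ψ a) s := fun _ _ => rfl
  rw [← hLdef χ⁻¹, ← hLdef χ] at h
  set l := DirichletCharacter.LFunction χ⁻¹ 1 with hl
  have hn1 : ‖χ⁻¹ (-1)‖ ≤ 1 := DirichletCharacter.norm_le_one _ _
  have hn2 : ‖χ (-1)‖ ≤ 1 := DirichletCharacter.norm_le_one _ _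
  have hb : ‖DirichletCharacter.LFunction χ 0‖ ≤ ‖τ‖ * ‖l‖ := by
    rw [h]
    have e : ((2 * π : ℂ)⁻¹ * (I * (χ⁻¹ (-1) * τ * l) + -I * (χ (-1) * (χ⁻¹ (-1) * τ) * l))) =
        (2 * π : ℂ)⁻¹ * (I * (χ⁻¹ (-1)) * (1 - χ (-1))) * (τ * l) := by ring
    rw [e, norm_mul, norm_mul τ]
    refine mul_le_of_le_one_left (by positivity) ?_
    rw [norm_mul, norm_mul, norm_mul, Complex.norm_I, norm_inv, norm_mul, Complex.norm_ofNat,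
      Complex.norm_real, Real.norm_of_nonneg Real.pi_pos.le, one_mul]
    have h3 : ‖1 - χ (-1)‖ ≤ 2 := by
      refine (norm_sub_le _ _).trans ?_
      rw [norm_one]
      linarith
    have h4 : ‖χ⁻¹ (-1)‖ * ‖1 - χ (-1)‖ ≤ 1 * 2 := by gcongr
    rw [inv_mul_le_iff₀ (by positivity)]
    nlinarith [Real.pi_gt_three]
  calc ‖DirichletCharacter.LFunction χ 0‖ ^ 2 ≤ (‖τ‖ * ‖l‖) ^ 2 := by gcongr
    _ = ‖τ‖ ^ 2 * ‖l‖ ^ 2 := by ring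
    _ = _ := by rw [hτ, norm_gaussSum_sq hχ]

theorem norm_sum_character_le {χ : DirichletCharacter ℂ q} (hχ : χ ≠ 1) (n : ℕ) :
    ‖∑ k ∈ Finset.Icc 1 n, χ ((k : ℕ) : ZMod q)‖ ≤ q := by
  have hq : q.Prime := Fact.out
  have hblock : ∀ m : ℕ, ∑ k ∈ Finset.range q, χ (((m * q + k : ℕ)) : ZMod q) = 0 := by
    intro m
    rw [← MulChar.sum_eq_zero_of_ne_one hχ]
    refine Finset.sum_bij (fun k _ => ((k : ℕ) : ZMod q)) (by simp) ?_ ?_ ?_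
    · intro a ha b hb hab
      rw [Finset.mem_range] at ha hb
      rw [ZMod.natCast_eq_natCast_iff'] at hab
      rwa [Nat.mod_eq_of_lt ha, Nat.mod_eq_of_lt hb] at hab
    · intro b _
      exact ⟨b.val, by simpa using ZMod.val_lt b, by simp⟩
    · intro a _
      simp
  have hfull : ∀ m : ℕ, ∑ k ∈ Finset.range (m * q), χ ((k : ℕ) : ZMod q) = 0 := by
    intro m
    induction m with
    | zero => simp
    | succ m ih => rw [Nat.succ_mul, Finset.sum_range_add, ih, hblock, add_zero]
  have h1 : ∑ k ∈ Finset.Icc 1 n, χ ((k : ℕ) : ZMod q) =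
      ∑ k ∈ Finset.range (n + 1), χ ((k : ℕ) : ZMod q) := by
    rw [Finset.range_eq_Ico, Finset.sum_eq_sum_Ico_succ_bot (by omega)]
    simp [MulChar.map_zero χ]
    rfl
  rw [h1, ← Nat.div_add_mod (n + 1) q, mul_comm q, Finset.sum_range_add, hfull, zero_add]
  refine (norm_sum_le _ _).trans ?_
  refine (Finset.sum_le_sum fun k _ => DirichletCharacter.norm_le_one χ _).trans ?_
  simp only [Finset.sum_const, Finset.card_range, nsmul_eq_mul, mul_one]
  exact_mod_cast (Nat.mod_lt _ hq.pos).le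

theorem norm_LFunction_one_sub_le {χ : DirichletCharacter ℂ q} (hχ : χ ≠ 1) {N : ℕ} (hN : 1 ≤ N) :
    ‖DirichletCharacter.LFunction χ 1 - ∑ n ∈ Finset.Icc 1 N, χ ((n : ℕ) : ZMod q) / n‖ ≤
      2 * q / N :=
  norm_sub_sum_div_le_of_partialSums_bounded (norm_sum_character_le hχ)
    (fun s hs => ZMod.LSeriesSummable_of_one_lt_re (fun a => χ a) (by simpa using hs))
    (fun s hs => DirichletCharacter.LFunction_eq_LSeries χ (by simpa using hs))
    (DirichletCharacter.differentiable_LFunction hχ 1).continuousAt hN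

theorem saw_neg (x : ℝ) : saw (-x) = -saw x := by
  unfold saw
  by_cases h : Int.fract x = 0
  · rw [if_pos h, if_pos (Int.fract_neg_eq_zero.mpr h), neg_zero]
  · rw [if_neg h, if_neg (by rwa [Int.fract_neg_eq_zero]), Int.fract_neg h]
    ring

theorem saw_intCast_div (m : ℤ) : saw ((m : ℝ) / q) = saw (((m : ZMod q).val : ℝ) / q) := by
  have h : Int.fract ((m : ℝ) / q) = Int.fract (((m : ZMod q).val : ℝ) / q) := by
    have h2 : (((m : ZMod q).val : ℤ)) = m % q := ZMod.val_intCast m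
    have h3 : (((m : ZMod q).val : ℝ)) = (((m : ZMod q).val : ℤ) : ℝ) := by push_cast; rfl
    rw [h3, h2, Int.fract_div_intCast_eq_div_intCast_mod,
      Int.fract_div_intCast_eq_div_intCast_mod, Int.emod_emod]
  unfold saw
  rw [h]

theorem sum_saw_eq_zero : ∑ a : ZMod q, saw ((a.val : ℝ) / q) = 0 := by
  have h : ∑ a : ZMod q, saw ((a.val : ℝ) / q) = -∑ a : ZMod q, saw ((a.val : ℝ) / q) := by
    conv_lhs => rw [← Equiv.sum_comp (Equiv.neg (ZMod q))]
    rw [← Finset.sum_neg_distrib]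
    refine Finset.sum_congr rfl fun a _ => ?_
    have h1 := saw_intCast_div (q := q) (-(a.val : ℤ))
    have h2 : ((-(a.val : ℤ) : ℤ) : ZMod q) = -a := by push_cast; simp
    rw [h2] at h1
    rw [Equiv.neg_apply, ← h1, ← saw_neg]
    push_cast
    rw [neg_div]
  linarith

theorem LFunction_zero_eq_sum_saw (χ : DirichletCharacter ℂ q) :
    DirichletCharacter.LFunction χ 0 = -∑ a : ZMod q, χ a * (saw ((a.val : ℝ) / q) : ℂ) := by
  have hq : q.Prime := Fact.out
  have hq0 : (0 : ℝ) < q := by exact_mod_cast hq.pos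
  have hd : DirichletCharacter.LFunction χ 0 = ZMod.LFunction (fun a => χ a) 0 := rfl
  rw [hd, ZMod.LFunction, neg_zero, Complex.cpow_zero, one_mul, ← Finset.sum_neg_distrib]
  refine Finset.sum_congr rfl fun a _ => ?_
  rcases eq_or_ne a 0 with rfl | ha
  · simp [MulChar.map_zero χ]
  · have hv : 0 < (a.val : ℝ) / q := by
      have : 0 < a.val := ZMod.val_pos.mpr ha
      positivity
    have hv1 : (a.val : ℝ) / q < 1 := by
      rw [div_lt_one hq0]
      exact_mod_cast ZMod.val_lt a
    rw [ZMod.toAddCircle_apply, hurwitzZeta_apply_zero hv hv1]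
    have hfr : Int.fract ((a.val : ℝ) / q) = (a.val : ℝ) / q :=
      Int.fract_eq_self.mpr ⟨hv.le, hv1⟩
    rw [saw, hfr, if_neg hv.ne']
    push_cast
    ring

theorem totient_mul_saw_eq {k u : ZMod q} (hu : u ≠ 0) :
    (q.totient : ℂ) * (saw (((k * u⁻¹).val : ℝ) / q) : ℂ) =
      -∑ χ ∈ Finset.univ.filter (fun χ : DirichletCharacter ℂ q => χ ≠ 1),
        (starRingEnd ℂ) (χ k) * χ u * DirichletCharacter.LFunction χ 0 := by
  have hall : ∑ χ ∈ Finset.univ.filter (fun χ : DirichletCharacter ℂ q => χ ≠ 1),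
        (starRingEnd ℂ) (χ k) * χ u * DirichletCharacter.LFunction χ 0 =
      ∑ χ : DirichletCharacter ℂ q, (starRingEnd ℂ) (χ k) * χ u *
        DirichletCharacter.LFunction χ 0 := by
    refine Finset.sum_filter_of_ne fun χ _ hne h1 => hne ?_
    have : DirichletCharacter.LFunction χ 0 = 0 := by
      rw [LFunction_zero_eq_sum_saw, h1, neg_eq_zero]
      have h2 : ∑ a : ZMod q, (saw ((a.val : ℝ) / q) : ℂ) = 0 := by
        rw [← Complex.ofReal_sum, sum_saw_eq_zero, Complex.ofReal_zero]
      rw [← h2]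
      refine Finset.sum_congr rfl fun a _ => ?_
      rcases eq_or_ne a 0 with rfl | ha
      · simp [saw]
      · rw [MulChar.one_apply (IsUnit.mk0 a ha), one_mul]
    rw [this, mul_zero]
  rw [hall]
  rcases eq_or_ne k 0 with rfl | hk
  · simp [saw, MulChar.map_zero]
  · simp_rw [LFunction_zero_eq_sum_saw, mul_neg, Finset.sum_neg_distrib, neg_neg, Finset.mul_sum]
    rw [Finset.sum_comm]
    have horth : ∀ a : ZMod q, ∑ χ : DirichletCharacter ℂ q,
        (starRingEnd ℂ) (χ k) * χ u * (χ a * (saw ((a.val : ℝ) / q) : ℂ)) =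
        if k * u⁻¹ = a then (q.totient : ℂ) * (saw ((a.val : ℝ) / q) : ℂ) else 0 := by
      intro a
      have h1 := DirichletCharacter.sum_char_inv_mul_char_eq ℂ (IsUnit.mk0 k hk) (u * a)
      have h2 : ∑ χ : DirichletCharacter ℂ q,
          (starRingEnd ℂ) (χ k) * χ u * (χ a * (saw ((a.val : ℝ) / q) : ℂ)) =
          (∑ χ : DirichletCharacter ℂ q, χ k⁻¹ * χ (u * a)) * (saw ((a.val : ℝ) / q) : ℂ) := by
        rw [Finset.sum_mul]
        refine Finset.sum_congr rfl fun χ _ => ?_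
        rw [dirichletCharacter_conj_apply, MulChar.inv_apply', map_mul]
        ring
      rw [h2, h1, ite_mul, zero_mul]
      refine if_congr ?_ rfl rfl
      constructor
      · rintro h
        rw [h]
        field_simp
      · rintro rfl
        field_simp
    rw [Finset.sum_congr rfl fun a _ => horth a, Finset.sum_ite_eq]
    simp

/-- Parseval's identity for combinations of conjugate characters. -/
theorem sum_norm_sq_sum_conj_mul (w : DirichletCharacter ℂ q → ℂ)
    (S : Finset (DirichletCharacter ℂ q)) :
    ∑ k : ZMod q, ‖∑ χ ∈ S, (starRingEnd ℂ) (χ k) * w χ‖ ^ 2 =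
      q.totient * ∑ χ ∈ S, ‖w χ‖ ^ 2 := by
  have horth : ∀ χ₁ χ₂ : DirichletCharacter ℂ q,
      ∑ k : ZMod q, (starRingEnd ℂ) (χ₁ k) * χ₂ k = if χ₁ = χ₂ then (q.totient : ℂ) else 0 := by
    intro χ₁ χ₂
    have h1 : ∀ k : ZMod q, (starRingEnd ℂ) (χ₁ k) * χ₂ k = (χ₁⁻¹ * χ₂) k := fun k => by
      rw [dirichletCharacter_conj_apply, MulChar.mul_apply]
    simp_rw [h1]
    split_ifs with h
    · rw [h, inv_mul_cancel, MulChar.sum_one_eq_card_units, ZMod.card_units_eq_totient]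
    · exact MulChar.sum_eq_zero_of_ne_one fun h2 => h (inv_mul_eq_one.mp h2)
  have hc : (∑ k : ZMod q, ((‖∑ χ ∈ S, (starRingEnd ℂ) (χ k) * w χ‖ ^ 2 : ℝ) : ℂ)) =
      q.totient * ∑ χ ∈ S, ((‖w χ‖ ^ 2 : ℝ) : ℂ) := by
    have h1 : ∀ k : ZMod q, ((‖∑ χ ∈ S, (starRingEnd ℂ) (χ k) * w χ‖ ^ 2 : ℝ) : ℂ) =
        ∑ χ₁ ∈ S, ∑ χ₂ ∈ S, (w χ₁ * (starRingEnd ℂ) (w χ₂)) *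
          ((starRingEnd ℂ) (χ₁ k) * χ₂ k) := by
      intro k
      rw [← Complex.normSq_eq_norm_sq, ← Complex.mul_conj, map_sum, Finset.sum_mul_sum]
      refine Finset.sum_congr rfl fun χ₁ _ => Finset.sum_congr rfl fun χ₂ _ => ?_
      rw [map_mul, Complex.conj_conj]
      ring
    simp_rw [h1]
    rw [Finset.sum_comm, Finset.mul_sum]
    refine Finset.sum_congr rfl fun χ₁ h₁ => ?_
    rw [Finset.sum_comm]
    simp_rw [← Finset.mul_sum, horth, mul_ite, mul_zero]
    rw [Finset.sum_ite_eq, if_pos h₁, ← Complex.normSq_eq_norm_sq, ← Complex.mul_conj]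
    ring
  exact_mod_cast hc

/-- Mean square over all characters of a finite character sum. -/
theorem sum_norm_sq_sum_mul_character_le (c : ℕ → ℂ) (S : Finset ℕ) :
    ∑ χ : DirichletCharacter ℂ q, ‖∑ m ∈ S, c m * χ ((m : ℕ) : ZMod q)‖ ^ 2 ≤
      q.totient * ∑ m ∈ S,
        ∑ n ∈ S.filter (fun n : ℕ => ((m : ℕ) : ZMod q) = ((n : ℕ) : ZMod q)),
          ‖c m‖ * ‖c n‖ := by
  have horth : ∀ a b : ZMod q, ‖∑ χ : DirichletCharacter ℂ q, χ a * (starRingEnd ℂ) (χ b)‖ ≤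
      if a = b then (q.totient : ℝ) else 0 := by
    intro a b
    rcases eq_or_ne b 0 with rfl | hb
    · simp only [MulChar.map_zero, map_zero, mul_zero, Finset.sum_const_zero, norm_zero]
      positivity
    · have h1 : ∑ χ : DirichletCharacter ℂ q, χ a * (starRingEnd ℂ) (χ b) =
          ∑ χ : DirichletCharacter ℂ q, χ b⁻¹ * χ a := by
        refine Finset.sum_congr rfl fun χ _ => ?_
        rw [dirichletCharacter_conj_apply, MulChar.inv_apply', mul_comm]
      rw [h1, DirichletCharacter.sum_char_inv_mul_char_eq ℂ (IsUnit.mk0 b hb)]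
      by_cases h : a = b
      · simp [h]
      · simp [h, Ne.symm h]
  have hc : ((∑ χ : DirichletCharacter ℂ q, ‖∑ m ∈ S, c m * χ ((m : ℕ) : ZMod q)‖ ^ 2 : ℝ) : ℂ) =
      ∑ m ∈ S, ∑ n ∈ S, c m * (starRingEnd ℂ) (c n) *
        ∑ χ : DirichletCharacter ℂ q, χ (m : ZMod q) * (starRingEnd ℂ) (χ (n : ZMod q)) := by
    push_cast
    have h1 : ∀ χ : DirichletCharacter ℂ q,
        ((‖∑ m ∈ S, c m * χ ((m : ℕ) : ZMod q)‖ : ℂ)) ^ 2 = ∑ m ∈ S, ∑ n ∈ S,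
          c m * (starRingEnd ℂ) (c n) * (χ (m : ZMod q) * (starRingEnd ℂ) (χ (n : ZMod q))) := by
      intro χ
      rw [← Complex.mul_conj', map_sum, Finset.sum_mul_sum]
      refine Finset.sum_congr rfl fun m _ => Finset.sum_congr rfl fun n _ => ?_
      rw [map_mul]
      ring
    simp_rw [h1]
    rw [Finset.sum_comm]
    refine Finset.sum_congr rfl fun m _ => ?_
    rw [Finset.sum_comm]
    simp_rw [Finset.mul_sum]
  have hnn : 0 ≤ ∑ χ : DirichletCharacter ℂ q, ‖∑ m ∈ S, c m * χ ((m : ℕ) : ZMod q)‖ ^ 2 :=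
    Finset.sum_nonneg fun _ _ => by positivity
  rw [← Real.norm_of_nonneg hnn, ← Complex.norm_real, hc, Finset.mul_sum]
  refine (norm_sum_le _ _).trans (Finset.sum_le_sum fun m _ => ?_)
  rw [Finset.sum_filter, Finset.mul_sum]
  refine (norm_sum_le _ _).trans (Finset.sum_le_sum fun n _ => ?_)
  rw [norm_mul, norm_mul, RCLike.norm_conj]
  refine (mul_le_mul_of_nonneg_left (horth _ _) (by positivity)).trans (le_of_eq ?_)
  split_ifs <;> ring

end Characters

section Coefficients

theorem aCoef_zero : aCoef 0 = 0 := by simp [aCoef]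

theorem aCoef_one : aCoef 1 = 1 := by simp [aCoef]

theorem aCoef_mul_of_coprime {m n : ℕ} (h : m.Coprime n) :
    aCoef (m * n) = aCoef m * aCoef n := by
  rcases eq_or_ne m 0 with rfl | hm
  · simp [aCoef_zero]
  rcases eq_or_ne n 0 with rfl | hn
  · simp [aCoef_zero]
  have hf : ∀ p, (m * n).factorization p = m.factorization p + n.factorization p := fun p => by
    rw [Nat.factorization_mul hm hn, Finsupp.add_apply]
  rw [aCoef, aCoef, aCoef, if_neg hm, if_neg hn, if_neg (mul_ne_zero hm hn),
    h.primeFactors_mul, Finset.prod_union h.disjoint_primeFactors]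
  congr 1
  · refine Finset.prod_congr rfl fun p hp => ?_
    have h0 : n.factorization p = 0 := by
      refine Finsupp.notMem_support_iff.mp ?_
      rw [Nat.support_factorization]
      exact Finset.disjoint_left.mp h.disjoint_primeFactors hp
    rcases eq_or_ne p 2 with rfl | h2
    · simp only [hf, h0, add_zero]
    · simp only [hf, h0, add_zero, if_neg h2]
  · refine Finset.prod_congr rfl fun p hp => ?_
    have h0 : m.factorization p = 0 := by
      refine Finsupp.notMem_support_iff.mp ?_
      rw [Nat.support_factorization]
      exact Finset.disjoint_right.mp h.disjoint_primeFactors hp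
    rcases eq_or_ne p 2 with rfl | h2
    · simp only [hf, h0, zero_add]
    · simp only [hf, h0, zero_add, if_neg h2]

theorem aCoef_two : aCoef 2 = -1 / 2 := by
  simp [aCoef, Nat.prime_two.primeFactors, Nat.prime_two.factorization_self]

theorem aCoef_two_pow {e : ℕ} (he : 2 ≤ e) : aCoef (2 ^ e) = 0 := by
  have h0 : e ≠ 0 := by omega
  have h1 : e ≠ 1 := by omega
  simp [aCoef, Nat.primeFactors_prime_pow h0 Nat.prime_two, Nat.prime_two.factorization_pow, h1]

theorem aCoef_prime {p : ℕ} (hp : p.Prime) (h2 : p ≠ 2) :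
    aCoef p = 2 / (p * (p - 2)) := by
  simp [aCoef, hp.ne_zero, hp.primeFactors, h2, hp.factorization_self]

theorem aCoef_prime_sq {p : ℕ} (hp : p.Prime) (h2 : p ≠ 2) :
    aCoef (p ^ 2) = -1 / (p * (p - 2)) := by
  simp [aCoef, hp.ne_zero, Nat.primeFactors_prime_pow two_ne_zero hp, h2, hp.factorization_pow]

theorem aCoef_prime_pow {p e : ℕ} (hp : p.Prime) (he : 3 ≤ e) : aCoef (p ^ e) = 0 := by
  have h0 : e ≠ 0 := by omega
  have h1 : e ≠ 1 := by omega
  have h2 : e ≠ 2 := by omega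
  rcases eq_or_ne p 2 with rfl | h
  · exact aCoef_two_pow (by omega)
  · simp [aCoef, hp.ne_zero, Nat.primeFactors_prime_pow h0 hp, h, hp.factorization_pow, h1, h2]

theorem abs_aCoef_le (n : ℕ) : |aCoef n| ≤ (n.divisors.card : ℝ) ^ 2 / n := by
  rcases eq_or_ne n 0 with rfl | hn
  · simp [aCoef_zero]
  have hprod : (n : ℝ) = ∏ p ∈ n.primeFactors, (p : ℝ) ^ n.factorization p := by
    conv_lhs => rw [← Nat.prod_factorization_pow_eq_self hn]
    simp [Finsupp.prod]
  have hdiv : (n.divisors.card : ℝ) ^ 2 / n = ∏ p ∈ n.primeFactors,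
      ((n.factorization p : ℝ) + 1) ^ 2 / (p : ℝ) ^ n.factorization p := by
    rw [Finset.prod_div_distrib, ← hprod, Finset.prod_pow, Nat.card_divisors hn]
    push_cast
    rfl
  rw [hdiv, aCoef, if_neg hn, Finset.abs_prod]
  refine Finset.prod_le_prod (fun _ _ => abs_nonneg _) fun p hp => ?_
  have hpp := Nat.prime_of_mem_primeFactors hp
  have h2p : (2 : ℝ) ≤ p := by exact_mod_cast hpp.two_le
  split_ifs with h h1 h1 h3
  · subst h
    rw [h1, abs_of_neg (by norm_num)]
    norm_num
  · rw [abs_zero]; positivity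
  · have h3p : (3 : ℝ) ≤ p := by exact_mod_cast (show 3 ≤ p by have := hpp.two_le; omega)
    rw [h1, abs_of_nonneg (by apply div_nonneg <;> nlinarith), div_le_div_iff₀ (by nlinarith)
      (by positivity)]
    norm_num
    nlinarith
  · have h3p : (3 : ℝ) ≤ p := by exact_mod_cast (show 3 ≤ p by have := hpp.two_le; omega)
    rw [h3, abs_div, abs_neg, abs_one, abs_of_pos (by nlinarith), div_le_div_iff₀ (by nlinarith)
      (by positivity)]
    norm_num
    nlinarith
  · rw [abs_zero]; positivity

theorem summable_abs_aCoef_mul_rpow : Summable fun n : ℕ => |aCoef n| * (n : ℝ) ^ (1 / 4 : ℝ) := by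
  set f : ℕ → ℝ := fun n => |aCoef n| * (n : ℝ) ^ (1 / 4 : ℝ) with hf
  have hf0 : ∀ n, 0 ≤ f n := fun n => by positivity
  have hf1 : f 1 = 1 := by simp [hf, aCoef_one]
  have hmul : ∀ {m n : ℕ}, m.Coprime n → f (m * n) = f m * f n := by
    intro m n h
    simp only [hf]
    rw [aCoef_mul_of_coprime h, abs_mul, Nat.cast_mul,
      Real.mul_rpow (Nat.cast_nonneg _) (Nat.cast_nonneg _)]
    ring
  have hz : ∀ {p : ℕ}, p.Prime → ∀ e ∉ Finset.range 3, f (p ^ e) = 0 := by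
    intro p hp e he
    simp [hf, aCoef_prime_pow hp (by simpa using he)]
  have hsum : ∀ {p : ℕ}, p.Prime → Summable (fun n : ℕ => ‖f (p ^ n)‖) := fun hp =>
    summable_of_ne_finset_zero (s := Finset.range 3) fun e he => by rw [hz hp e he, norm_zero]
  have hloc : ∀ {p : ℕ}, p.Prime →
      ∑' e : ℕ, f (p ^ e) ≤ 1 + 9 * (p : ℝ) ^ (-(3 / 2) : ℝ) := by
    intro p hp
    rw [tsum_eq_sum (s := Finset.range 3) fun e he => hz hp e he]
    simp only [Finset.sum_range_succ, Finset.sum_range_zero, pow_zero, pow_one, hf1]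
    have hp1 : (1 : ℝ) ≤ p := by exact_mod_cast hp.one_le
    have hp0 : (0 : ℝ) < p := by linarith
    have hq : (p : ℝ) ^ (1 / 4 : ℝ) ≤ (p : ℝ) ^ (1 / 2 : ℝ) :=
      Real.rpow_le_rpow_of_exponent_le hp1 (by norm_num)
    have hsq : ((p ^ 2 : ℕ) : ℝ) ^ (1 / 4 : ℝ) = (p : ℝ) ^ (1 / 2 : ℝ) := by
      rw [Nat.cast_pow, ← Real.rpow_natCast, ← Real.rpow_mul hp0.le]
      norm_num
    have hh : (p : ℝ) ^ (-(3 / 2) : ℝ) = (p : ℝ) ^ (1 / 2 : ℝ) / (p : ℝ) ^ 2 := by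
      rw [← Real.rpow_natCast, ← Real.rpow_sub hp0]
      norm_num
    have hpos : 0 < (p : ℝ) ^ (1 / 2 : ℝ) := Real.rpow_pos_of_pos hp0 _
    have key : |aCoef p| + |aCoef (p ^ 2)| ≤ 9 / (p : ℝ) ^ 2 := by
      rcases eq_or_ne p 2 with rfl | h2
      · rw [aCoef_two, aCoef_two_pow le_rfl, abs_of_neg (by norm_num)]
        norm_num
      · have h3p : (3 : ℝ) ≤ p := by
          exact_mod_cast (show 3 ≤ p by have := hp.two_le; omega)
        rw [aCoef_prime hp h2, aCoef_prime_sq hp h2, abs_div, abs_div, abs_neg, abs_one,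
          abs_of_pos (show (0 : ℝ) < p * (p - 2) by nlinarith), ← add_div, abs_two,
          div_le_div_iff₀ (by nlinarith) (by positivity)]
        nlinarith
    have h1 : f p ≤ |aCoef p| * (p : ℝ) ^ (1 / 2 : ℝ) :=
      mul_le_mul_of_nonneg_left hq (abs_nonneg _)
    have h2 : f (p ^ 2) = |aCoef (p ^ 2)| * (p : ℝ) ^ (1 / 2 : ℝ) := by
      simp only [hf, hsq]
    have h3 := mul_le_mul_of_nonneg_right key hpos.le
    rw [hh, h2]
    calc 0 + 1 + f p + |aCoef (p ^ 2)| * (p : ℝ) ^ (1 / 2 : ℝ)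
        ≤ 1 + (|aCoef p| + |aCoef (p ^ 2)|) * (p : ℝ) ^ (1 / 2 : ℝ) := by linarith
      _ ≤ 1 + 9 / (p : ℝ) ^ 2 * (p : ℝ) ^ (1 / 2 : ℝ) := by linarith
      _ = _ := by ring
  have hs32 : Summable fun n : ℕ => (n : ℝ) ^ (-(3 / 2) : ℝ) :=
    Real.summable_nat_rpow.mpr (by norm_num)
  refine summable_of_sum_le hf0 (c := Real.exp (9 * ∑' n : ℕ, (n : ℝ) ^ (-(3 / 2) : ℝ)))
    fun s => ?_
  obtain ⟨M, hM⟩ := s.exists_nat_subset_range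
  obtain ⟨hS, hH⟩ :=
    EulerProduct.summable_and_hasSum_factoredNumbers_prod_filter_prime_tsum hf1 hmul hsum
      (Finset.range M)
  have hle : ∑ n ∈ s, f n ≤ ∏ p ∈ Finset.range M with p.Prime, ∑' n : ℕ, f (p ^ n) := by
    rw [← hH.tsum_eq]
    have h0 : ∑ n ∈ s, f n = ∑ n ∈ s.erase 0, f n := by
      rw [Finset.sum_erase]
      simp [hf, aCoef_zero]
    have hmem : ∀ n ∈ s.erase 0, n ∈ Nat.factoredNumbers (Finset.range M) := by
      intro n hn
      rw [Finset.mem_erase] at hn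
      rw [Nat.mem_factoredNumbers_iff_primeFactors_subset]
      refine ⟨hn.1, fun p hp => ?_⟩
      have hnM := Finset.mem_range.mp (hM hn.2)
      exact Finset.mem_range.mpr ((Nat.le_of_mem_primeFactors hp).trans_lt hnM)
    rw [h0, ← Finset.sum_attach]
    have := hH.summable.sum_le_tsum ((s.erase 0).attach.map
      ⟨fun x => ⟨x.1, hmem x.1 x.2⟩, fun a b hab => Subtype.ext (Subtype.mk.inj hab)⟩)
      (fun i _ => hf0 _)
    rwa [Finset.sum_map] at this
  refine hle.trans ?_
  calc ∏ p ∈ Finset.range M with p.Prime, ∑' n : ℕ, f (p ^ n)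
      ≤ ∏ p ∈ Finset.range M with p.Prime, Real.exp (9 * (p : ℝ) ^ (-(3 / 2) : ℝ)) := by
        refine Finset.prod_le_prod (fun p _ => tsum_nonneg fun _ => hf0 _) fun p hp => ?_
        refine (hloc (Finset.mem_filter.mp hp).2).trans ?_
        rw [add_comm]
        exact Real.add_one_le_exp _
    _ = Real.exp (9 * ∑ p ∈ Finset.range M with p.Prime, (p : ℝ) ^ (-(3 / 2) : ℝ)) := by
        rw [← Real.exp_sum, Finset.mul_sum]
    _ ≤ _ := by
        refine Real.exp_le_exp.mpr (mul_le_mul_of_nonneg_left ?_ (by norm_num))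
        exact hs32.sum_le_tsum _ fun n _ => by positivity

theorem summable_abs_aCoef : Summable fun n : ℕ => |aCoef n| := by
  refine Summable.of_nonneg_of_le (fun _ => abs_nonneg _) (fun n => ?_) summable_abs_aCoef_mul_rpow
  rcases Nat.eq_zero_or_pos n with rfl | hn
  · simp [aCoef_zero]
  · refine le_mul_of_one_le_right (abs_nonneg _) (Real.one_le_rpow ?_ (by norm_num))
    exact_mod_cast hn

/-- The tail of the coefficient series. -/
theorem norm_tsum_sub_sum_aCoef_mul_le {g : ℕ → ℂ} (hg : ∀ n, ‖g n‖ ≤ 1) {N : ℕ} (hN : 1 ≤ N) :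
    ‖∑' n : ℕ, (aCoef n : ℂ) * g n - ∑ n ∈ Finset.Icc 1 N, (aCoef n : ℂ) * g n‖ ≤
      (∑' n : ℕ, |aCoef n| * (n : ℝ) ^ (1 / 4 : ℝ)) * (N : ℝ) ^ (-(1 / 4) : ℝ) := by
  have hnorm : ∀ n, ‖(aCoef n : ℂ) * g n‖ ≤ |aCoef n| := fun n => by
    rw [norm_mul, Complex.norm_real, Real.norm_eq_abs]
    exact mul_le_of_le_one_right (abs_nonneg _) (hg n)
  have hs : Summable fun n : ℕ => (aCoef n : ℂ) * g n :=
    Summable.of_norm_bounded summable_abs_aCoef hnorm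
  have h1 : ∑ n ∈ Finset.Icc 1 N, (aCoef n : ℂ) * g n =
      ∑ n ∈ Finset.range (N + 1), (aCoef n : ℂ) * g n := by
    rw [Finset.range_eq_Ico, Finset.sum_eq_sum_Ico_succ_bot (Nat.succ_pos N), aCoef_zero]
    simp only [Complex.ofReal_zero, zero_mul, zero_add]
    rfl
  have hN0 : (0 : ℝ) < N := by exact_mod_cast hN
  rw [h1, ← hs.sum_add_tsum_nat_add (N + 1), add_sub_cancel_left, mul_comm, ← tsum_mul_left]
  have hs' := (summable_abs_aCoef_mul_rpow.mul_left ((N : ℝ) ^ (-(1 / 4) : ℝ)))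
  refine (tsum_of_norm_bounded (((summable_nat_add_iff (N + 1)).mpr hs').hasSum)
    fun n => ?_).trans ?_
  · refine (hnorm _).trans ?_
    rw [mul_left_comm]
    refine le_mul_of_one_le_right (abs_nonneg _) ?_
    rw [Real.rpow_neg hN0.le, inv_mul_eq_div, one_le_div (Real.rpow_pos_of_pos hN0 _)]
    refine Real.rpow_le_rpow hN0.le ?_ (by norm_num)
    push_cast
    linarith [n.cast_nonneg (α := ℝ)]
  · rw [← hs'.sum_add_tsum_nat_add (N + 1)]
    exact le_add_of_nonneg_left (Finset.sum_nonneg fun _ _ => by positivity)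

end Coefficients

section EulerProduct

theorem Cq_factor_mem_Icc (q : ℕ) (p : Nat.Primes) :
    (if (p : ℕ) = 2 ∨ (p : ℕ) ∣ q then (1 : ℝ) else 1 - 1 / ((p : ℝ) - 1) ^ 2) ∈
      Set.Icc (0 : ℝ) 1 := by
  split_ifs with h
  · exact ⟨zero_le_one, le_rfl⟩
  · have h2 : (2 : ℝ) ≤ (p : ℕ) := by exact_mod_cast p.2.two_le
    have h1 : 1 / (((p : ℕ) : ℝ) - 1) ^ 2 ≤ 1 := by
      rw [div_le_one (by nlinarith)]
      nlinarith
    exact ⟨by linarith, by linarith [show 0 ≤ 1 / (((p : ℕ) : ℝ) - 1) ^ 2 by positivity]⟩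

theorem multipliable_Cq (q : ℕ) : Multipliable fun p : Nat.Primes =>
    if (p : ℕ) = 2 ∨ (p : ℕ) ∣ q then (1 : ℝ) else 1 - 1 / ((p : ℝ) - 1) ^ 2 := by
  have hs : Summable fun p : Nat.Primes => 4 / ((p : ℕ) : ℝ) ^ 2 := by
    have := (Real.summable_one_div_nat_pow.mpr (one_lt_two)).mul_left (4 : ℝ)
    refine (this.comp_injective Nat.Primes.coe_nat_injective).congr fun p => ?_
    simp only [Function.comp_apply]
    ring
  have hs' : Summable fun p : Nat.Primes =>
      if (p : ℕ) = 2 ∨ (p : ℕ) ∣ q then (0 : ℝ) else -(1 / ((p : ℝ) - 1) ^ 2) := by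
    refine Summable.of_norm_bounded hs fun p => ?_
    have h2 : (2 : ℝ) ≤ (p : ℕ) := by exact_mod_cast p.2.two_le
    split_ifs
    · rw [norm_zero]; positivity
    · rw [norm_neg, Real.norm_of_nonneg (by positivity), div_le_div_iff₀ (by nlinarith)
        (by nlinarith)]
      nlinarith
  have hm := multipliable_one_add_of_summable hs'.norm
  refine hm.congr fun p => ?_
  split_ifs <;> ring

theorem abs_Cq_le (q : ℕ) : |Cq q| ≤ 2 := by
  have h := (multipliable_Cq q).hasProd
  have h0 : 0 ≤ ∏' p : Nat.Primes,
      if (p : ℕ) = 2 ∨ (p : ℕ) ∣ q then (1 : ℝ) else 1 - 1 / ((p : ℝ) - 1) ^ 2 :=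
    ge_of_tendsto' h fun s => Finset.prod_nonneg fun p _ => (Cq_factor_mem_Icc q p).1
  have h1 : ∏' p : Nat.Primes,
      (if (p : ℕ) = 2 ∨ (p : ℕ) ∣ q then (1 : ℝ) else 1 - 1 / ((p : ℝ) - 1) ^ 2) ≤ 1 :=
    le_of_tendsto' h fun s => Finset.prod_le_one (fun p _ => (Cq_factor_mem_Icc q p).1)
      fun p _ => (Cq_factor_mem_Icc q p).2
  rw [Cq, abs_of_nonneg (by positivity)]
  linarith

theorem Aq_eq {q : ℕ} [Fact q.Prime] (hq : Odd q) (χ : DirichletCharacter ℂ q) :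
    Aq q χ = Cq q * χ 2 * ∑' n : ℕ, (aCoef n : ℂ) * χ (n : ZMod q) := by
  have hqp : q.Prime := Fact.out
  set f : ℕ → ℂ := fun n => (aCoef n : ℂ) * χ (n : ZMod q) with hf
  have hsum : Summable fun n => ‖f n‖ := by
    refine Summable.of_nonneg_of_le (fun _ => norm_nonneg _) (fun n => ?_) summable_abs_aCoef
    rw [hf, norm_mul, Complex.norm_real, Real.norm_eq_abs]
    exact mul_le_of_le_one_right (abs_nonneg _) (χ.norm_le_one _)
  have hw : HasProd (fun p : Nat.Primes => ∑' e, f ((p : ℕ) ^ e)) (∑' n, f n) := by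
    refine EulerProduct.eulerProduct_hasProd (by simp [hf, aCoef_one]) ?_ hsum
      (by simp [hf, aCoef_zero])
    intro m n h
    simp only [hf]
    rw [aCoef_mul_of_coprime h]
    push_cast
    rw [map_mul]
    ring
  have hloc : ∀ p : ℕ, p.Prime → ∑' e, f (p ^ e) =
      1 + aCoef p * χ (p : ZMod q) + aCoef (p ^ 2) * χ (p : ZMod q) ^ 2 := by
    intro p hp
    rw [tsum_eq_sum (s := Finset.range 3) fun e he => by
      simp [hf, aCoef_prime_pow hp (by simpa using he)]]
    simp [Finset.sum_range_succ, hf, aCoef_one]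
  have ht : HasProd (fun p : Nat.Primes => if (p : ℕ) = 2 then 2 * χ 2 else 1) (2 * χ 2) := by
    have h := hasProd_ite_eq (⟨2, Nat.prime_two⟩ : Nat.Primes) (2 * χ 2)
    refine h.congr_fun fun p => ?_
    exact if_congr (Nat.Primes.coe_nat_inj p ⟨2, Nat.prime_two⟩) rfl rfl
  have hv := (multipliable_Cq q).hasProd.map Complex.ofRealHom Complex.continuous_ofReal
  have hall := (ht.mul hv).mul hw
  have hC : (Cq q : ℂ) * χ 2 * ∑' n : ℕ, (aCoef n : ℂ) * χ (n : ZMod q) =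
      2 * χ 2 * Complex.ofRealHom (∏' p : Nat.Primes,
        if (p : ℕ) = 2 ∨ (p : ℕ) ∣ q then (1 : ℝ) else 1 - 1 / ((p : ℝ) - 1) ^ 2) *
        ∑' n, f n := by
    rw [Cq, Complex.ofRealHom_eq_coe, Complex.ofReal_mul, Complex.ofReal_ofNat]
    ring
  rw [hC, ← hall.tprod_eq, Aq]
  refine tprod_congr fun P => ?_
  have hp : (P : ℕ).Prime := P.2
  simp only [Function.comp_apply, hloc P hp]
  generalize (P : ℕ) = p at hp ⊢
  rcases eq_or_ne p 2 with rfl | h2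
  · have hnd : ¬ 2 ∣ q := fun h => by
      obtain ⟨k, hk⟩ := hq
      omega
    rw [if_neg hnd, if_pos rfl, if_pos (Or.inl rfl), aCoef_two, aCoef_two_pow le_rfl]
    push_cast
    simp only [map_one]
    ring
  · rw [if_neg h2]
    by_cases hd : p ∣ q
    · have hpq : p = q := (Nat.prime_dvd_prime_iff_eq hp hqp).mp hd
      rw [if_pos hd, if_pos (Or.inr hd), hpq, ZMod.natCast_self, MulChar.map_zero]
      simp
    · rw [if_neg hd, if_neg (by tauto), aCoef_prime hp h2, aCoef_prime_sq hp h2,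
        Complex.ofRealHom_eq_coe]
      have h3p : 3 ≤ p := by have := hp.two_le; omega
      have e1 : (p : ℂ) ≠ 0 := by exact_mod_cast hp.ne_zero
      have e2 : (p : ℂ) - 1 ≠ 0 := by
        rw [sub_ne_zero]
        exact_mod_cast (show p ≠ 1 by omega)
      have e3 : (p : ℂ) - 2 ≠ 0 := by
        rw [sub_ne_zero]
        exact_mod_cast (show p ≠ 2 by omega)
      push_cast
      field_simp
      ring

end EulerProduct

section DivisorBound

/-- The divisor bound. -/
theorem exists_card_divisors_le {η : ℝ} (hη : 0 < η) :
    ∃ K : ℝ, 1 ≤ K ∧ ∀ n : ℕ, n ≠ 0 → (n.divisors.card : ℝ) ≤ K * (n : ℝ) ^ η := by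
  have hl2 : 0 < Real.log 2 := Real.log_pos one_lt_two
  set D : ℝ := max 1 (1 / (η * Real.log 2)) with hD
  have hD1 : 1 ≤ D := le_max_left _ _
  have hD2 : 1 ≤ D * (η * Real.log 2) := by
    have h : 1 / (η * Real.log 2) ≤ D := le_max_right _ _
    rwa [div_le_iff₀ (by positivity)] at h
  set P : ℕ := ⌈(2 : ℝ) ^ (1 / η)⌉₊ with hP
  have hloc : ∀ p e : ℕ, 2 ≤ p →
      ((e : ℝ) + 1) ≤ (if p < P then D else 1) * ((p : ℝ) ^ e) ^ η := by
    intro p e hp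
    have h2p : (2 : ℝ) ≤ p := by exact_mod_cast hp
    have hcomm : ∀ x : ℝ, 0 ≤ x → (x ^ e) ^ η = (x ^ η) ^ e := fun x hx => by
      rw [← Real.rpow_natCast, ← Real.rpow_natCast, ← Real.rpow_mul hx, ← Real.rpow_mul hx,
        mul_comm]
    split_ifs with h
    · have h1 : ((2 : ℝ) ^ e) ^ η ≤ ((p : ℝ) ^ e) ^ η :=
        Real.rpow_le_rpow (by positivity) (pow_le_pow_left₀ (by norm_num) h2p _) hη.le
      have h3 : (e : ℝ) * (η * Real.log 2) + 1 ≤ ((2 : ℝ) ^ e) ^ η := by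
        rw [← Real.rpow_natCast, ← Real.rpow_mul zero_le_two, Real.rpow_def_of_pos two_pos]
        refine le_trans (le_of_eq ?_) (Real.add_one_le_exp _)
        ring
      calc (e : ℝ) + 1 ≤ e * (D * (η * Real.log 2)) + D := by
            have := mul_le_mul_of_nonneg_left hD2 (Nat.cast_nonneg (α := ℝ) e)
            linarith
        _ = D * (e * (η * Real.log 2) + 1) := by ring
        _ ≤ D * ((p : ℝ) ^ e) ^ η :=
            mul_le_mul_of_nonneg_left (h3.trans h1) (by linarith)
    · have hpP : (2 : ℝ) ^ (1 / η) ≤ p :=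
        (Nat.le_ceil _).trans (by exact_mod_cast not_lt.mp h)
      have h2 : (2 : ℝ) ≤ (p : ℝ) ^ η := by
        have := Real.rpow_le_rpow (by positivity) hpP hη.le
        rwa [← Real.rpow_mul zero_le_two, one_div_mul_cancel hη.ne', Real.rpow_one] at this
      rw [one_mul, hcomm _ (by positivity)]
      refine le_trans ?_ (pow_le_pow_left₀ zero_le_two h2 e)
      exact_mod_cast Nat.lt_two_pow_self (n := e)
  refine ⟨D ^ P, one_le_pow₀ hD1, fun n hn => ?_⟩
  have hprod : (n : ℝ) = ∏ p ∈ n.primeFactors, (p : ℝ) ^ n.factorization p := by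
    conv_lhs => rw [← Nat.prod_factorization_pow_eq_self hn]
    simp [Finsupp.prod]
  have hrp : (n : ℝ) ^ η = ∏ p ∈ n.primeFactors, ((p : ℝ) ^ n.factorization p) ^ η := by
    rw [Real.finsetProd_rpow _ _ fun _ _ => by positivity, ← hprod]
  rw [Nat.card_divisors hn]
  push_cast
  calc ∏ p ∈ n.primeFactors, ((n.factorization p : ℝ) + 1)
      ≤ ∏ p ∈ n.primeFactors,
          (if p < P then D else 1) * ((p : ℝ) ^ n.factorization p) ^ η :=
        Finset.prod_le_prod (fun _ _ => by positivity) fun p hp =>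
          hloc p _ (Nat.prime_of_mem_primeFactors hp).two_le
    _ = (∏ p ∈ n.primeFactors, if p < P then D else 1) * (n : ℝ) ^ η := by
        rw [Finset.prod_mul_distrib, hrp]
    _ ≤ D ^ P * (n : ℝ) ^ η := by
        refine mul_le_mul_of_nonneg_right ?_ (by positivity)
        rw [Finset.prod_ite, Finset.prod_const, Finset.prod_const_one, mul_one]
        refine pow_le_pow_right₀ hD1 ?_
        calc _ ≤ (Finset.range P).card := Finset.card_le_card fun p hp =>
              Finset.mem_range.mpr (Finset.mem_filter.mp hp).2
          _ = P := Finset.card_range P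

end DivisorBound

section Convolution

/-- Dirichlet convolution of real sequences. -/
noncomputable def dirichletConv (f g : ℕ → ℝ) (n : ℕ) : ℝ :=
  ∑ x ∈ n.divisorsAntidiagonal, f x.1 * g x.2

/-- The truncation of a sequence at `N`. -/
noncomputable def cutoff (N : ℕ) (f : ℕ → ℝ) (n : ℕ) : ℝ := if n ≤ N then f n else 0

theorem sum_mul_sum_eq_sum_dirichletConv {f g : ℕ → ℝ} {N M : ℕ} (hf : ∀ n, N < n → f n = 0)
    (hg : ∀ n, M < n → g n = 0) {X : ℕ → ℂ} (hX : ∀ m n, X (m * n) = X m * X n) :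
    (∑ u ∈ Finset.Icc 1 N, (f u : ℂ) * X u) * (∑ v ∈ Finset.Icc 1 M, (g v : ℂ) * X v) =
      ∑ n ∈ Finset.Icc 1 (N * M), (dirichletConv f g n : ℂ) * X n := by
  rw [Finset.sum_mul_sum, ← Finset.sum_product',
    ← Finset.sum_fiberwise_of_maps_to (t := Finset.Icc 1 (N * M)) (g := fun x => x.1 * x.2)]
  · refine Finset.sum_congr rfl fun n hn => ?_
    rw [dirichletConv, Complex.ofReal_sum, Finset.sum_mul]
    have hn0 : n ≠ 0 := by
      have := (Finset.mem_Icc.mp hn).1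
      omega
    have hterm : ∀ x ∈ n.divisorsAntidiagonal,
        ((f x.1 * g x.2 : ℝ) : ℂ) * X n = (f x.1 : ℂ) * X x.1 * ((g x.2 : ℂ) * X x.2) := by
      intro x hx
      rw [← (Nat.mem_divisorsAntidiagonal.mp hx).1, hX]
      push_cast
      ring
    rw [Finset.sum_congr rfl hterm]
    refine Finset.sum_subset (fun x hx => ?_) fun x hx hx' => ?_
    · exact Nat.mem_divisorsAntidiagonal.mpr ⟨(Finset.mem_filter.mp hx).2, hn0⟩
    · obtain ⟨h1, -⟩ := Nat.mem_divisorsAntidiagonal.mp hx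
      have hx1 : x.1 ≠ 0 := fun h => hn0 (by rw [← h1, h, zero_mul])
      have hx2 : x.2 ≠ 0 := fun h => hn0 (by rw [← h1, h, mul_zero])
      have hor : N < x.1 ∨ M < x.2 := by
        by_contra! hcon
        refine hx' (Finset.mem_filter.mpr ⟨Finset.mem_product.mpr
          ⟨Finset.mem_Icc.mpr ?_, Finset.mem_Icc.mpr ?_⟩, h1⟩) <;> omega
      rcases hor with h | h
      · rw [hf _ h]; simp
      · rw [hg _ h]; simp
  · intro x hx
    obtain ⟨h1, h2⟩ := Finset.mem_product.mp hx
    rw [Finset.mem_Icc] at h1 h2 ⊢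
    exact ⟨Nat.one_le_iff_ne_zero.mpr (mul_ne_zero (by omega) (by omega)),
      Nat.mul_le_mul h1.2 h2.2⟩

theorem abs_dirichletConv_le {f g : ℕ → ℝ} {a b : ℕ}
    (hf : ∀ n, |f n| ≤ (n.divisors.card : ℝ) ^ a / n)
    (hg : ∀ n, |g n| ≤ (n.divisors.card : ℝ) ^ b / n) (n : ℕ) :
    |dirichletConv f g n| ≤ (n.divisors.card : ℝ) ^ (a + b + 1) / n := by
  rcases eq_or_ne n 0 with rfl | hn
  · simp [dirichletConv]
  have hcard : n.divisorsAntidiagonal.card = n.divisors.card := by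
    rw [Finset.card_eq_sum_ones, Finset.card_eq_sum_ones,
      Nat.sum_divisorsAntidiagonal (f := fun _ _ => 1)]
  refine (Finset.abs_sum_le_sum_abs _ _).trans ((Finset.sum_le_card_nsmul _ _
    ((n.divisors.card : ℝ) ^ (a + b) / n) fun x hx => ?_).trans (le_of_eq ?_))
  · have h1 := (Nat.mem_divisorsAntidiagonal.mp hx).1
    have hd1 : (x.1.divisors.card : ℝ) ≤ n.divisors.card := by
      exact_mod_cast Finset.card_le_card (Nat.divisors_subset_of_dvd hn ⟨x.2, h1.symm⟩)
    have hd2 : (x.2.divisors.card : ℝ) ≤ n.divisors.card := by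
      exact_mod_cast Finset.card_le_card (Nat.divisors_subset_of_dvd hn (Dvd.intro_left _ h1))
    have hn' : (n : ℝ) = x.1 * x.2 := by exact_mod_cast h1.symm
    rw [abs_mul]
    calc |f x.1| * |g x.2|
        ≤ (x.1.divisors.card : ℝ) ^ a / x.1 * ((x.2.divisors.card : ℝ) ^ b / x.2) :=
          mul_le_mul (hf _) (hg _) (abs_nonneg _) (by positivity)
      _ = (x.1.divisors.card : ℝ) ^ a * (x.2.divisors.card : ℝ) ^ b / n := by
          rw [div_mul_div_comm, hn']
      _ ≤ (n.divisors.card : ℝ) ^ (a + b) / n := by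
          rw [pow_add]
          gcongr
  · rw [hcard, nsmul_eq_mul]
    ring

theorem abs_cutoff_le {f : ℕ → ℝ} {a : ℕ} (hf : ∀ n, |f n| ≤ (n.divisors.card : ℝ) ^ a / n)
    (N n : ℕ) : |cutoff N f n| ≤ (n.divisors.card : ℝ) ^ a / n := by
  rw [cutoff]
  split_ifs
  · exact hf n
  · rw [abs_zero]; positivity

/-- The product `S (G S - P)`, with `S`, `G` the truncated series of `1 / n` and `a(n)` and `P` the
initial part of the series of `b(n)`, is a Dirichlet polynomial supported on `n > B` whose
coefficients satisfy a divisor bound. -/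
theorem exists_tail_coefficients {B N : ℕ} (hBN : B ≤ N) :
    ∃ c : ℕ → ℝ, (∀ n, |c n| ≤ (n.divisors.card : ℝ) ^ 4 / n) ∧
      ∀ X : ℕ → ℂ, (∀ m n, X (m * n) = X m * X n) →
        (∑ n ∈ Finset.Icc 1 N, X n / n) *
          ((∑ n ∈ Finset.Icc 1 N, (aCoef n : ℂ) * X n) * (∑ n ∈ Finset.Icc 1 N, X n / n) -
            ∑ n ∈ Finset.Icc 1 B, (bCoef n : ℂ) * X n) =
        ∑ n ∈ Finset.Ioc B (N * (N * N)), (c n : ℂ) * X n := by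
  set a' : ℕ → ℝ := cutoff N aCoef with ha'
  set r : ℕ → ℝ := cutoff N (fun n => 1 / (n : ℝ)) with hr
  set t : ℕ → ℝ := fun n => if n ≤ B then 0 else dirichletConv a' r n with ht
  have ha'b : ∀ n, |a' n| ≤ (n.divisors.card : ℝ) ^ 2 / n := abs_cutoff_le abs_aCoef_le N
  have hrb : ∀ n, |r n| ≤ (n.divisors.card : ℝ) ^ 0 / n := abs_cutoff_le (fun n => by
    rw [pow_zero, abs_of_nonneg (by positivity)]) N
  have htb : ∀ n, |t n| ≤ (n.divisors.card : ℝ) ^ 3 / n := fun n => by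
    simp only [ht]
    split_ifs
    · rw [abs_zero]; positivity
    · exact abs_dirichletConv_le ha'b hrb n
  have ha'0 : ∀ n, N < n → a' n = 0 := fun n hn => if_neg (not_le.mpr hn)
  have hr0 : ∀ n, N < n → r n = 0 := fun n hn => if_neg (not_le.mpr hn)
  have ht0 : ∀ n, N * N < n → t n = 0 := fun n hn => by
    simp only [ht]
    split_ifs with h
    · rfl
    · refine Finset.sum_eq_zero fun x hx => ?_
      have h1 := (Nat.mem_divisorsAntidiagonal.mp hx).1
      rcases le_or_gt x.1 N with h | h
      · rcases le_or_gt x.2 N with h' | h'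
        · have := Nat.mul_le_mul h h'
          omega
        · rw [hr0 _ h', mul_zero]
      · rw [ha'0 _ h, zero_mul]
  have hb : ∀ n, n ≤ B → dirichletConv a' r n = bCoef n := fun n hn => by
    rcases eq_or_ne n 0 with rfl | hn0
    · simp [dirichletConv, bCoef]
    rw [dirichletConv, Nat.sum_divisorsAntidiagonal (f := fun u v => a' u * r v), bCoef]
    refine Finset.sum_congr rfl fun u hu => ?_
    have h1 : u ≤ N := (Nat.divisor_le hu).trans (hn.trans hBN)
    have h2 : n / u ≤ N := (Nat.div_le_self _ _).trans (hn.trans hBN)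
    simp only [ha', hr, cutoff, if_pos h1, if_pos h2]
    ring
  refine ⟨dirichletConv r t, fun n => by simpa using abs_dirichletConv_le hrb htb n,
    fun X hX => ?_⟩
  have hS : ∑ n ∈ Finset.Icc 1 N, X n / n = ∑ n ∈ Finset.Icc 1 N, (r n : ℂ) * X n :=
    Finset.sum_congr rfl fun n hn => by
      simp only [hr, cutoff, if_pos (Finset.mem_Icc.mp hn).2]
      push_cast
      ring
  have hG : ∑ n ∈ Finset.Icc 1 N, (aCoef n : ℂ) * X n = ∑ n ∈ Finset.Icc 1 N, (a' n : ℂ) * X n :=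
    Finset.sum_congr rfl fun n hn => by
      simp only [ha', cutoff, if_pos (Finset.mem_Icc.mp hn).2]
  rcases Nat.eq_zero_or_pos N with rfl | hN
  · simp
  have hBN2 : B ≤ N * N := hBN.trans (Nat.le_mul_of_pos_left N hN)
  have hsplit : ∀ (g : ℕ → ℂ) (M : ℕ), B ≤ M → ∑ n ∈ Finset.Icc 1 M, g n =
      ∑ n ∈ Finset.Icc 1 B, g n + ∑ n ∈ Finset.Ioc B M, g n := fun g M hM => by
    have hI : ∀ K, Finset.Icc 1 K = Finset.Ioc 0 K := fun K => rfl
    rw [hI, hI, Finset.sum_Ioc_consecutive _ (Nat.zero_le _) hM]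
  have htail : (∑ n ∈ Finset.Icc 1 N, (a' n : ℂ) * X n) * (∑ n ∈ Finset.Icc 1 N, (r n : ℂ) * X n) -
      ∑ n ∈ Finset.Icc 1 B, (bCoef n : ℂ) * X n =
        ∑ n ∈ Finset.Icc 1 (N * N), (t n : ℂ) * X n := by
    rw [sum_mul_sum_eq_sum_dirichletConv ha'0 hr0 hX, hsplit _ _ hBN2, hsplit _ _ hBN2]
    have h1 : ∑ n ∈ Finset.Icc 1 B, (dirichletConv a' r n : ℂ) * X n =
        ∑ n ∈ Finset.Icc 1 B, (bCoef n : ℂ) * X n :=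
      Finset.sum_congr rfl fun n hn => by rw [hb n (Finset.mem_Icc.mp hn).2]
    have h2 : ∑ n ∈ Finset.Icc 1 B, (t n : ℂ) * X n = 0 :=
      Finset.sum_eq_zero fun n hn => by simp [ht, (Finset.mem_Icc.mp hn).2]
    have h3 : ∑ n ∈ Finset.Ioc B (N * N), (t n : ℂ) * X n =
        ∑ n ∈ Finset.Ioc B (N * N), (dirichletConv a' r n : ℂ) * X n :=
      Finset.sum_congr rfl fun n hn => by
        simp only [ht, if_neg (not_le.mpr (Finset.mem_Ioc.mp hn).1)]
    rw [h1, h2, h3]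
    ring
  rw [hS, hG, htail, sum_mul_sum_eq_sum_dirichletConv hr0 ht0 hX,
    hsplit _ _ (hBN2.trans (Nat.le_mul_of_pos_left _ hN)), Finset.sum_eq_zero, zero_add]
  intro n hn
  rw [Finset.mem_Icc] at hn
  have h0 : dirichletConv r t n = 0 := Finset.sum_eq_zero fun x hx => by
    have h1 : x.2 ≤ B := (Nat.le_of_dvd hn.1
      (Dvd.intro_left _ (Nat.mem_divisorsAntidiagonal.mp hx).1)).trans hn.2
    simp [ht, h1]
  simp [h0]

end Convolution

section CongruentPairs

theorem sum_rpow_filter_congr_le {η : ℝ} (hη : 0 < η) {q : ℕ} (hq : 1 ≤ q) (S : Finset ℕ) (m : ℕ) :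
    ∑ n ∈ S.filter (fun n : ℕ => m < n ∧ ((m : ℕ) : ZMod q) = ((n : ℕ) : ZMod q)),
        (n : ℝ) ^ (-1 - η) ≤ (∑' n : ℕ, (n : ℝ) ^ (-1 - η)) / q := by
  set T := S.filter (fun n : ℕ => m < n ∧ ((m : ℕ) : ZMod q) = ((n : ℕ) : ZMod q)) with hT
  have hq0 : (0 : ℝ) < q := by exact_mod_cast hq
  have hsum : Summable fun n : ℕ => (n : ℝ) ^ (-1 - η) :=
    Real.summable_nat_rpow.mpr (by linarith)
  have hex : ∀ n ∈ T, 0 < (n - m) / q ∧ n = m + q * ((n - m) / q) := by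
    intro n hn
    obtain ⟨-, h1, h2⟩ := Finset.mem_filter.mp hn
    have hd : q ∣ n - m :=
      (Nat.modEq_iff_dvd' h1.le).mp ((ZMod.natCast_eq_natCast_iff _ _ _).mp h2)
    obtain ⟨j, hj⟩ := hd
    have hj' : (n - m) / q = j := by rw [hj, Nat.mul_div_cancel_left _ hq]
    rw [hj', ← hj]
    refine ⟨Nat.pos_of_ne_zero fun h => ?_, by omega⟩
    rw [h, mul_zero] at hj
    omega
  have hinj : Set.InjOn (fun n => (n - m) / q) T := by
    intro x hx y hy hxy
    rw [(hex x hx).2, (hex y hy).2]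
    simp only at hxy
    rw [hxy]
  calc ∑ n ∈ T, (n : ℝ) ^ (-1 - η)
      ≤ ∑ n ∈ T, (((n - m) / q : ℕ) : ℝ) ^ (-1 - η) / q := by
        refine Finset.sum_le_sum fun n hn => ?_
        obtain ⟨hj, hn'⟩ := hex n hn
        set j := (n - m) / q with hjdef
        have hj0 : (0 : ℝ) < j := by exact_mod_cast hj
        have hle : (q : ℝ) * j ≤ n := by
          exact_mod_cast (show q * j ≤ n by omega)
        calc (n : ℝ) ^ (-1 - η) ≤ ((q : ℝ) * j) ^ (-1 - η) :=
              Real.rpow_le_rpow_of_nonpos (by positivity) hle (by linarith)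
          _ = (q : ℝ) ^ (-1 - η) * (j : ℝ) ^ (-1 - η) := Real.mul_rpow hq0.le hj0.le
          _ ≤ (q : ℝ) ^ (-1 : ℝ) * (j : ℝ) ^ (-1 - η) := by
              refine mul_le_mul_of_nonneg_right ?_ (by positivity)
              exact Real.rpow_le_rpow_of_exponent_le (by exact_mod_cast hq) (by linarith)
          _ = _ := by rw [Real.rpow_neg_one]; ring
    _ = (∑ j ∈ T.image (fun n => (n - m) / q), (j : ℝ) ^ (-1 - η)) / q := by
        rw [Finset.sum_image hinj, Finset.sum_div]
    _ ≤ _ := by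
        refine div_le_div_of_nonneg_right ?_ hq0.le
        exact hsum.sum_le_tsum _ fun n _ => by positivity

theorem sum_sum_filter_congr_le {η D : ℝ} (hη : 0 < η) (hη3 : 3 * η ≤ 1) {q b M : ℕ} (hq : 1 ≤ q)
    (hb : 1 ≤ b) {c : ℕ → ℝ} (hc : ∀ n : ℕ, n ≠ 0 → |c n| ≤ D * (n : ℝ) ^ (-1 + η)) :
    ∑ m ∈ Finset.Ioc b M,
        ∑ n ∈ (Finset.Ioc b M).filter (fun n : ℕ => ((m : ℕ) : ZMod q) = ((n : ℕ) : ZMod q)),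
          |c m| * |c n| ≤
      D ^ 2 * ((∑' n : ℕ, (n : ℝ) ^ (-1 - η)) * (b : ℝ) ^ (-1 + 3 * η) +
        2 * (∑' n : ℕ, (n : ℝ) ^ (-1 - η)) ^ 2 * (M : ℝ) ^ (4 * η) / q) := by
  set Z := ∑' n : ℕ, (n : ℝ) ^ (-1 - η) with hZ
  set S := Finset.Ioc b M with hS
  have hsum : Summable fun n : ℕ => (n : ℝ) ^ (-1 - η) :=
    Real.summable_nat_rpow.mpr (by linarith)
  have hZ0 : 0 ≤ Z := tsum_nonneg fun n => by positivity
  have hSZ : ∑ n ∈ S, (n : ℝ) ^ (-1 - η) ≤ Z := hsum.sum_le_tsum _ fun n _ => by positivity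
  have hD : 0 ≤ D := by
    have := (abs_nonneg _).trans (hc 1 one_ne_zero)
    simpa using this
  have hb0 : (0 : ℝ) < b := by exact_mod_cast hb
  have hq0 : (0 : ℝ) < q := by exact_mod_cast hq
  have hmem : ∀ n ∈ S, n ≠ 0 ∧ (0 : ℝ) < n ∧ (b : ℝ) ≤ n ∧ (n : ℝ) ≤ M := by
    intro n hn
    obtain ⟨h1, h2⟩ := Finset.mem_Ioc.mp hn
    exact ⟨by omega, by exact_mod_cast (show 0 < n by omega), by exact_mod_cast h1.le,
      by exact_mod_cast h2⟩
  have hcM : ∀ n ∈ S, |c n| ≤ D * (M : ℝ) ^ (2 * η) * (n : ℝ) ^ (-1 - η) := by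
    intro n hn
    obtain ⟨h0, hp, -, hM⟩ := hmem n hn
    refine (hc n h0).trans ?_
    rw [mul_assoc]
    refine mul_le_mul_of_nonneg_left ?_ hD
    calc (n : ℝ) ^ (-1 + η) = (n : ℝ) ^ (2 * η) * (n : ℝ) ^ (-1 - η) := by
          rw [← Real.rpow_add hp]
          ring_nf
      _ ≤ _ := mul_le_mul_of_nonneg_right (Real.rpow_le_rpow hp.le hM (by linarith))
          (by positivity)
  have hdiag : ∑ m ∈ S, |c m| * |c m| ≤ D ^ 2 * (Z * (b : ℝ) ^ (-1 + 3 * η)) := by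
    calc ∑ m ∈ S, |c m| * |c m|
        ≤ ∑ m ∈ S, D ^ 2 * (b : ℝ) ^ (-1 + 3 * η) * (m : ℝ) ^ (-1 - η) := by
          refine Finset.sum_le_sum fun m hm => ?_
          obtain ⟨h0, hp, hbm, -⟩ := hmem m hm
          calc |c m| * |c m| ≤ (D * (m : ℝ) ^ (-1 + η)) * (D * (m : ℝ) ^ (-1 + η)) :=
                mul_self_le_mul_self (abs_nonneg _) (hc m h0)
            _ = D ^ 2 * ((m : ℝ) ^ (-1 + 3 * η) * (m : ℝ) ^ (-1 - η)) := by
                rw [← Real.rpow_add hp, mul_mul_mul_comm, ← Real.rpow_add hp]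
                ring_nf
            _ ≤ D ^ 2 * ((b : ℝ) ^ (-1 + 3 * η) * (m : ℝ) ^ (-1 - η)) := by
                have := Real.rpow_le_rpow_of_nonpos hb0 hbm (show -1 + 3 * η ≤ 0 by linarith)
                gcongr
            _ = _ := by ring
      _ = D ^ 2 * (b : ℝ) ^ (-1 + 3 * η) * ∑ m ∈ S, (m : ℝ) ^ (-1 - η) := by
          rw [Finset.mul_sum]
      _ ≤ D ^ 2 * (b : ℝ) ^ (-1 + 3 * η) * Z := by gcongr
      _ = _ := by ring
  have hoff : ∑ m ∈ S, ∑ n ∈ S.filter (fun n : ℕ => m < n ∧ ((m : ℕ) : ZMod q) =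
      ((n : ℕ) : ZMod q)), |c m| * |c n| ≤ D ^ 2 * (Z ^ 2 * (M : ℝ) ^ (4 * η) / q) := by
    have hMM : (M : ℝ) ^ (4 * η) = (M : ℝ) ^ (2 * η) * (M : ℝ) ^ (2 * η) := by
      rw [← Real.rpow_add_of_nonneg (Nat.cast_nonneg _) (by linarith) (by linarith)]
      ring_nf
    calc _ ≤ ∑ m ∈ S, (D * (M : ℝ) ^ (2 * η) * (m : ℝ) ^ (-1 - η)) *
          (D * (M : ℝ) ^ (2 * η) * (Z / q)) := by
          refine Finset.sum_le_sum fun m hm => ?_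
          rw [← Finset.mul_sum]
          refine mul_le_mul (hcM m hm) ?_ (Finset.sum_nonneg fun _ _ => abs_nonneg _)
            (by positivity)
          refine (Finset.sum_le_sum fun n hn => hcM n (Finset.mem_filter.mp hn).1).trans ?_
          rw [← Finset.mul_sum]
          exact mul_le_mul_of_nonneg_left (sum_rpow_filter_congr_le hη hq S m) (by positivity)
      _ = (D * (M : ℝ) ^ (2 * η) * (D * (M : ℝ) ^ (2 * η) * (Z / q))) *
          ∑ m ∈ S, (m : ℝ) ^ (-1 - η) := by
          rw [Finset.mul_sum]
          exact Finset.sum_congr rfl fun _ _ => by ring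
      _ ≤ (D * (M : ℝ) ^ (2 * η) * (D * (M : ℝ) ^ (2 * η) * (Z / q))) * Z := by gcongr
      _ = _ := by rw [hMM]; ring
  have hswap : ∑ m ∈ S, ∑ n ∈ S.filter (fun n : ℕ => n < m ∧ ((m : ℕ) : ZMod q) =
        ((n : ℕ) : ZMod q)), |c m| * |c n| =
      ∑ m ∈ S, ∑ n ∈ S.filter (fun n : ℕ => m < n ∧ ((m : ℕ) : ZMod q) =
        ((n : ℕ) : ZMod q)), |c m| * |c n| := by
    simp only [Finset.sum_filter]
    rw [Finset.sum_comm]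
    refine Finset.sum_congr rfl fun m _ => Finset.sum_congr rfl fun n _ => ?_
    exact if_congr (and_congr_right fun _ => eq_comm) (mul_comm _ _) rfl
  have hsplit : ∑ m ∈ S, ∑ n ∈ S.filter (fun n : ℕ => ((m : ℕ) : ZMod q) = ((n : ℕ) : ZMod q)),
        |c m| * |c n| = ∑ m ∈ S, |c m| * |c m| +
      (∑ m ∈ S, ∑ n ∈ S.filter (fun n : ℕ => m < n ∧ ((m : ℕ) : ZMod q) = ((n : ℕ) : ZMod q)),
        |c m| * |c n| +
      ∑ m ∈ S, ∑ n ∈ S.filter (fun n : ℕ => n < m ∧ ((m : ℕ) : ZMod q) = ((n : ℕ) : ZMod q)),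
        |c m| * |c n|) := by
    simp only [Finset.sum_filter]
    rw [← Finset.sum_add_distrib, ← Finset.sum_add_distrib]
    refine Finset.sum_congr rfl fun m hm => ?_
    have hmm : |c m| * |c m| = ∑ n ∈ S, if m = n then |c m| * |c n| else 0 := by
      rw [Finset.sum_ite_eq, if_pos hm]
    rw [hmm, ← Finset.sum_add_distrib, ← Finset.sum_add_distrib]
    refine Finset.sum_congr rfl fun n _ => ?_
    rcases lt_trichotomy m n with h | rfl | h
    · simp [h, h.ne, h.not_gt]
    · simp
    · simp [h, h.ne', h.not_gt]
  rw [hsplit, hswap]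
  calc _ ≤ D ^ 2 * (Z * (b : ℝ) ^ (-1 + 3 * η)) + (D ^ 2 * (Z ^ 2 * (M : ℝ) ^ (4 * η) / q) +
        D ^ 2 * (Z ^ 2 * (M : ℝ) ^ (4 * η) / q)) := by gcongr
    _ = _ := by ring

end CongruentPairs

section MeanSquare

variable {q : ℕ} [Fact q.Prime]

/-- The error made when `L(1, χ) ∑ a(n) χ(n) = ∑ b(n) χ(n)` is replaced by its partial sum. -/
noncomputable def approxError (b : ℕ) (χ : DirichletCharacter ℂ q) : ℂ :=
  DirichletCharacter.LFunction χ 1 * ∑' n : ℕ, (aCoef n : ℂ) * χ (n : ZMod q) -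
    ∑ n ∈ Finset.Icc 1 b, (bCoef n : ℂ) * χ (n : ZMod q)

theorem Cfun_add_eq_re (hq : Odd q) {b : ℕ} (hb : b < q) (k : ℤ) :
    Cfun q k + Cq q * ∑ n ∈ Finset.Icc 1 b,
        bCoef n * saw (((k * invMod q (2 * n) : ℤ) : ℝ) / q) =
      ((q.totient : ℂ)⁻¹ * ∑ χ ∈ Finset.univ.filter (fun χ : DirichletCharacter ℂ q => χ ≠ 1),
        (starRingEnd ℂ) (χ (k : ZMod q)) *
          (Cq q * χ 2 * DirichletCharacter.LFunction χ 0 * approxError b χ)).re := by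
  have hqp : q.Prime := Fact.out
  have hφ : (q.totient : ℂ) ≠ 0 := by exact_mod_cast (Nat.totient_pos.mpr hqp.pos).ne'
  have hsaw : ∀ n ∈ Finset.Icc 1 b, (saw (((k * invMod q (2 * n) : ℤ) : ℝ) / q) : ℂ) =
      -((q.totient : ℂ)⁻¹ * ∑ χ ∈ Finset.univ.filter (fun χ : DirichletCharacter ℂ q => χ ≠ 1),
        (starRingEnd ℂ) (χ (k : ZMod q)) * χ ((2 * n : ℕ) : ZMod q) *
          DirichletCharacter.LFunction χ 0) := by
    intro n hn
    rw [Finset.mem_Icc] at hn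
    have hu : ((2 * n : ℕ) : ZMod q) ≠ 0 := by
      rw [Ne, ZMod.natCast_eq_zero_iff, hqp.dvd_mul]
      rintro (h | h)
      · have := (Nat.prime_dvd_prime_iff_eq hqp Nat.prime_two).mp h
        subst this
        exact absurd hq (by decide)
      · have := Nat.le_of_dvd hn.1 h
        omega
    have hcast : ((k * invMod q (2 * n) : ℤ) : ZMod q) =
        (k : ZMod q) * ((2 * n : ℕ) : ZMod q)⁻¹ := by
      rw [Int.cast_mul, Int.cast_natCast, invMod, ZMod.natCast_zmod_val]
    rw [saw_intCast_div, hcast, ← mul_neg, ← totient_mul_saw_eq hu, inv_mul_cancel_left₀ hφ]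
  have hsum : ((Cq q * ∑ n ∈ Finset.Icc 1 b,
        bCoef n * saw (((k * invMod q (2 * n) : ℤ) : ℝ) / q) : ℝ) : ℂ) =
      -((q.totient : ℂ)⁻¹ * ∑ χ ∈ Finset.univ.filter (fun χ : DirichletCharacter ℂ q => χ ≠ 1),
        (starRingEnd ℂ) (χ (k : ZMod q)) * (Cq q * χ 2 * DirichletCharacter.LFunction χ 0 *
          ∑ n ∈ Finset.Icc 1 b, (bCoef n : ℂ) * χ (n : ZMod q))) := by
    push_cast
    have h1 : ∀ n ∈ Finset.Icc 1 b,
        (bCoef n : ℂ) * (saw ((k : ℝ) * (invMod q (2 * n) : ℝ) / q) : ℂ) =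
        -((q.totient : ℂ)⁻¹ * ∑ χ ∈ Finset.univ.filter (fun χ : DirichletCharacter ℂ q => χ ≠ 1),
          (starRingEnd ℂ) (χ (k : ZMod q)) * χ 2 * DirichletCharacter.LFunction χ 0 *
            (bCoef n * χ (n : ZMod q))) := by
      intro n hn
      have h2 := hsaw n hn
      push_cast at h2
      rw [h2, mul_neg, mul_left_comm, Finset.mul_sum]
      refine congrArg _ (congrArg _ (Finset.sum_congr rfl fun χ _ => ?_))
      rw [map_mul]
      ring
    rw [Finset.sum_congr rfl h1, Finset.sum_neg_distrib, ← Finset.mul_sum, Finset.sum_comm,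
      mul_neg, mul_left_comm, Finset.mul_sum]
    refine congrArg _ (congrArg _ (Finset.sum_congr rfl fun χ _ => ?_))
    rw [← Finset.mul_sum]
    ring
  rw [← Complex.ofReal_re (Cq q * ∑ n ∈ Finset.Icc 1 b,
        bCoef n * saw (((k * invMod q (2 * n) : ℤ) : ℝ) / q)), hsum, Cfun, dif_neg hqp.ne_zero,
    ← Complex.add_re, ← sub_eq_add_neg, ← mul_sub, ← Finset.sum_sub_distrib]
  refine congrArg _ (congrArg _ (Finset.sum_congr rfl fun χ _ => ?_))
  rw [Aq_eq hq, approxError]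
  ring

theorem sum_range_eq_sum_zmod (f : ZMod q → ℝ) :
    ∑ k ∈ Finset.range q, f ((k : ℤ) : ZMod q) = ∑ a : ZMod q, f a := by
  refine Finset.sum_bij' (fun k _ => ((k : ℤ) : ZMod q)) (fun a _ => a.val) (by simp)
    (fun a _ => Finset.mem_range.mpr a.val_lt) (fun k hk => ?_) (fun a _ => ?_) (fun _ _ => rfl)
  · rw [Int.cast_natCast, ZMod.val_cast_of_lt (Finset.mem_range.mp hk)]
  · rw [Int.cast_natCast, ZMod.natCast_zmod_val]

theorem mean_square_le (hq : Odd q) {b : ℕ} (hb : b < q) :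
    (1 / q.totient : ℝ) * ∑ k ∈ Finset.range q,
        |Cfun q k + Cq q * ∑ n ∈ Finset.Icc 1 b,
          bCoef n * saw ((((k : ℤ) * invMod q (2 * n) : ℤ) : ℝ) / q)| ^ 2 ≤
      4 * q / (q.totient : ℝ) ^ 2 *
        ∑ χ ∈ Finset.univ.filter (fun χ : DirichletCharacter ℂ q => χ ≠ 1),
          (‖DirichletCharacter.LFunction χ⁻¹ 1‖ * ‖approxError b χ‖) ^ 2 := by
  have hqp : q.Prime := Fact.out
  have hφ : (0 : ℝ) < q.totient := by exact_mod_cast Nat.totient_pos.mpr hqp.pos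
  set T := Finset.univ.filter (fun χ : DirichletCharacter ℂ q => χ ≠ 1) with hT
  set w : DirichletCharacter ℂ q → ℂ := fun χ =>
    Cq q * χ 2 * DirichletCharacter.LFunction χ 0 * approxError b χ with hw
  have h1 : ∀ k ∈ Finset.range q, |Cfun q k + Cq q * ∑ n ∈ Finset.Icc 1 b,
      bCoef n * saw ((((k : ℤ) * invMod q (2 * n) : ℤ) : ℝ) / q)| ^ 2 ≤
      ((q.totient : ℝ) ^ 2)⁻¹ * ‖∑ χ ∈ T, (starRingEnd ℂ) (χ ((k : ℤ) : ZMod q)) * w χ‖ ^ 2 := by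
    intro k _
    rw [Cfun_add_eq_re hq hb k]
    refine (pow_le_pow_left₀ (abs_nonneg _) (Complex.abs_re_le_norm _) 2).trans (le_of_eq ?_)
    rw [norm_mul, mul_pow, norm_inv, Complex.norm_natCast, inv_pow]
  have hw2 : ∀ χ ∈ T, ‖w χ‖ ^ 2 ≤
      4 * q * (‖DirichletCharacter.LFunction χ⁻¹ 1‖ * ‖approxError b χ‖) ^ 2 := by
    intro χ hχ
    have hL := norm_LFunction_zero_le (Finset.mem_filter.mp hχ).2
    have hC : ‖(Cq q : ℂ) * χ 2‖ ≤ 2 := by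
      rw [norm_mul, Complex.norm_real, Real.norm_eq_abs]
      exact (mul_le_of_le_one_right (abs_nonneg _) (χ.norm_le_one _)).trans (abs_Cq_le q)
    have hC2 : ‖(Cq q : ℂ) * χ 2‖ ^ 2 ≤ 4 := by
      have := pow_le_pow_left₀ (norm_nonneg _) hC 2
      norm_num at this ⊢
      exact this
    simp only [hw]
    rw [norm_mul, norm_mul _ (DirichletCharacter.LFunction χ 0), mul_pow, mul_pow]
    calc _ ≤ 4 * (q * ‖DirichletCharacter.LFunction χ⁻¹ 1‖ ^ 2) * ‖approxError b χ‖ ^ 2 := by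
          gcongr
      _ = _ := by ring
  calc _ ≤ (1 / q.totient : ℝ) * ∑ k ∈ Finset.range q, ((q.totient : ℝ) ^ 2)⁻¹ *
        ‖∑ χ ∈ T, (starRingEnd ℂ) (χ ((k : ℤ) : ZMod q)) * w χ‖ ^ 2 := by
        gcongr with k hk
        exact h1 k hk
    _ = ((q.totient : ℝ) ^ 2)⁻¹ * ∑ χ ∈ T, ‖w χ‖ ^ 2 := by
        rw [← Finset.mul_sum, sum_range_eq_sum_zmod
          (fun a => ‖∑ χ ∈ T, (starRingEnd ℂ) (χ a) * w χ‖ ^ 2), sum_norm_sq_sum_conj_mul]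
        field_simp
    _ ≤ ((q.totient : ℝ) ^ 2)⁻¹ * ∑ χ ∈ T,
        4 * q * (‖DirichletCharacter.LFunction χ⁻¹ 1‖ * ‖approxError b χ‖) ^ 2 := by
        gcongr with χ hχ
        exact hw2 χ hχ
    _ = _ := by
        rw [← Finset.mul_sum]
        ring

end MeanSquare

section Truncation

variable {q : ℕ} [Fact q.Prime]

theorem one_le_tsum_abs_aCoef_mul_rpow :
    1 ≤ ∑' n : ℕ, |aCoef n| * (n : ℝ) ^ (1 / 4 : ℝ) := by
  refine le_trans ?_ (summable_abs_aCoef_mul_rpow.le_tsum 1 fun _ _ => by positivity)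
  simp [aCoef_one]

theorem sum_abs_aCoef_le (S : Finset ℕ) :
    ∑ n ∈ S, |aCoef n| ≤ ∑' n : ℕ, |aCoef n| * (n : ℝ) ^ (1 / 4 : ℝ) := by
  refine le_trans (Finset.sum_le_sum fun n _ => ?_)
    (summable_abs_aCoef_mul_rpow.sum_le_tsum S fun _ _ => by positivity)
  rcases Nat.eq_zero_or_pos n with rfl | hn
  · simp [aCoef_zero]
  · refine le_mul_of_one_le_right (abs_nonneg _) (Real.one_le_rpow ?_ (by norm_num))
    exact_mod_cast hn

theorem abs_bCoef_le (n : ℕ) : |bCoef n| ≤ ∑' n : ℕ, |aCoef n| * (n : ℝ) ^ (1 / 4 : ℝ) := by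
  rw [bCoef]
  refine (Finset.abs_sum_le_sum_abs _ _).trans
    ((Finset.sum_le_sum fun u _ => ?_).trans (sum_abs_aCoef_le n.divisors))
  rw [abs_div, Nat.abs_cast]
  rcases Nat.eq_zero_or_pos (n / u) with h | h
  · rw [h]; simp
  · exact div_le_self (abs_nonneg _) (by exact_mod_cast h)

theorem norm_LFunction_mul_approxError_le {χ : DirichletCharacter ℂ q} (hχ : χ ≠ 1) {b : ℕ}
    (hb : b < q) :
    ‖DirichletCharacter.LFunction χ⁻¹ 1‖ * ‖approxError b χ‖ ≤
      ‖(∑ n ∈ Finset.Icc 1 (q ^ 12), χ (n : ZMod q) / n) *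
        ((∑ n ∈ Finset.Icc 1 (q ^ 12), (aCoef n : ℂ) * χ (n : ZMod q)) *
          (∑ n ∈ Finset.Icc 1 (q ^ 12), χ (n : ZMod q) / n) -
            ∑ n ∈ Finset.Icc 1 b, (bCoef n : ℂ) * χ (n : ZMod q))‖ +
      40 * (∑' n : ℕ, |aCoef n| * (n : ℝ) ^ (1 / 4 : ℝ)) / q := by
  have hqp : q.Prime := Fact.out
  have hq2 : (2 : ℝ) ≤ q := by exact_mod_cast hqp.two_le
  have hq0 : (0 : ℝ) < q := by linarith
  have hN : 1 ≤ q ^ 12 := Nat.one_le_pow _ _ hqp.pos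
  have hχ' : χ⁻¹ ≠ 1 := inv_ne_one.mpr hχ
  set K := ∑' n : ℕ, |aCoef n| * (n : ℝ) ^ (1 / 4 : ℝ) with hK
  have hK1 : 1 ≤ K := one_le_tsum_abs_aCoef_mul_rpow
  set S := ∑ n ∈ Finset.Icc 1 (q ^ 12), χ (n : ZMod q) / n with hS
  set GN := ∑ n ∈ Finset.Icc 1 (q ^ 12), (aCoef n : ℂ) * χ (n : ZMod q) with hGN
  set G := ∑' n : ℕ, (aCoef n : ℂ) * χ (n : ZMod q) with hG
  set P := ∑ n ∈ Finset.Icc 1 b, (bCoef n : ℂ) * χ (n : ZMod q) with hP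
  have hconj : ‖∑ n ∈ Finset.Icc 1 (q ^ 12), χ⁻¹ (n : ZMod q) / n‖ = ‖S‖ := by
    rw [← RCLike.norm_conj S, hS, map_sum]
    congr 1
    refine Finset.sum_congr rfl fun n _ => ?_
    rw [map_div₀, dirichletCharacter_conj_apply, Complex.conj_natCast]
  have herr : 2 * (q : ℝ) / (q ^ 12 : ℕ) ≤ 2 / q ^ 3 := by
    rw [Nat.cast_pow, div_le_div_iff₀ (by positivity) (by positivity)]
    have : (q : ℝ) ^ 4 ≤ q ^ 12 := pow_le_pow_right₀ (by linarith) (by norm_num)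
    linarith [show 2 * (q : ℝ) * q ^ 3 = 2 * q ^ 4 by ring]
  have hLS : ‖DirichletCharacter.LFunction χ 1 - S‖ ≤ 2 / q ^ 3 :=
    (norm_LFunction_one_sub_le hχ hN).trans herr
  have hα : ‖DirichletCharacter.LFunction χ⁻¹ 1‖ ≤ ‖S‖ + 2 / q ^ 3 := by
    rw [← hconj]
    have h1 := (norm_LFunction_one_sub_le hχ' hN).trans herr
    have h2 := norm_sub_norm_le (DirichletCharacter.LFunction χ⁻¹ 1)
      (∑ n ∈ Finset.Icc 1 (q ^ 12), χ⁻¹ (n : ZMod q) / n)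
    linarith
  have hL3 : ‖DirichletCharacter.LFunction χ 1‖ ≤ 1 + 2 * q := by
    have h1 := norm_LFunction_one_sub_le hχ (le_refl 1)
    simp only [Finset.Icc_self, Finset.sum_singleton, Nat.cast_one, map_one, div_one] at h1
    have h2 := norm_sub_norm_le (DirichletCharacter.LFunction χ 1) 1
    rw [norm_one] at h2
    linarith
  have hq3 : 2 / (q : ℝ) ^ 3 ≤ 1 / 2 * q := by
    rw [div_le_iff₀ (by positivity)]
    have : (2 : ℝ) ^ 4 ≤ q ^ 4 := pow_le_pow_left₀ (by norm_num) hq2 4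
    linarith [show 1 / 2 * (q : ℝ) * q ^ 3 = 1 / 2 * q ^ 4 by ring]
  have hSn : ‖S‖ ≤ 4 * q := by
    have h1 := norm_sub_norm_le S (DirichletCharacter.LFunction χ 1)
    rw [norm_sub_rev] at h1
    linarith
  have hGd : ‖G - GN‖ ≤ K / q ^ 3 := by
    refine (norm_tsum_sub_sum_aCoef_mul_le (fun n => χ.norm_le_one _) hN).trans (le_of_eq ?_)
    have h3 : ((q ^ 12 : ℕ) : ℝ) ^ (-(1 / 4) : ℝ) = ((q : ℝ) ^ 3)⁻¹ := by
      rw [Nat.cast_pow, ← Real.rpow_natCast, ← Real.rpow_mul hq0.le, ← Real.rpow_natCast,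
        ← Real.rpow_neg hq0.le]
      norm_num
    rw [h3]
    exact (div_eq_mul_inv _ _).symm
  have hGNn : ‖GN‖ ≤ K := by
    refine (norm_sum_le _ _).trans ((Finset.sum_le_sum fun n _ => ?_).trans (sum_abs_aCoef_le _))
    rw [norm_mul, Complex.norm_real, Real.norm_eq_abs]
    exact mul_le_of_le_one_right (abs_nonneg _) (χ.norm_le_one _)
  have hPn : ‖P‖ ≤ K * q := by
    refine (norm_sum_le_of_le _ fun n _ => show _ ≤ K from ?_).trans ?_
    · rw [norm_mul, Complex.norm_real, Real.norm_eq_abs]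
      exact (mul_le_of_le_one_right (abs_nonneg _) (χ.norm_le_one _)).trans (abs_bCoef_le n)
    · rw [Finset.sum_const, Nat.card_Icc, nsmul_eq_mul, mul_comm]
      refine mul_le_mul_of_nonneg_left ?_ (by linarith)
      exact_mod_cast (by omega : b + 1 - 1 ≤ q)
  have hWd : ‖approxError b χ - (GN * S - P)‖ ≤ 7 * K / q ^ 2 := by
    have h1 : approxError b χ - (GN * S - P) =
        DirichletCharacter.LFunction χ 1 * (G - GN) +
          (DirichletCharacter.LFunction χ 1 - S) * GN := by
      rw [approxError]
      ring
    rw [h1]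
    refine (norm_add_le _ _).trans ?_
    rw [norm_mul, norm_mul]
    calc _ ≤ (1 + 2 * q) * (K / q ^ 3) + 2 / q ^ 3 * K := by gcongr
      _ = (3 + 2 * q) * K / q ^ 3 := by ring
      _ ≤ 7 * q * K / q ^ 3 := by gcongr; linarith
      _ = _ := by field_simp
  have hWN : ‖GN * S - P‖ ≤ 5 * K * q := by
    refine (norm_sub_le _ _).trans ?_
    rw [norm_mul]
    calc _ ≤ K * (4 * q) + K * q := by gcongr
      _ = _ := by ring
  have hW : ‖approxError b χ‖ ≤ ‖GN * S - P‖ + 7 * K / q ^ 2 := by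
    have := norm_sub_norm_le (approxError b χ) (GN * S - P)
    linarith
  rw [norm_mul]
  calc _ ≤ (‖S‖ + 2 / q ^ 3) * (‖GN * S - P‖ + 7 * K / q ^ 2) := by gcongr
    _ = ‖S‖ * ‖GN * S - P‖ + (‖S‖ * (7 * K / q ^ 2) + 2 / q ^ 3 * ‖GN * S - P‖ +
        2 / q ^ 3 * (7 * K / q ^ 2)) := by ring
    _ ≤ ‖S‖ * ‖GN * S - P‖ + (4 * q * (7 * K / q ^ 2) + 2 / q ^ 3 * (5 * K * q) +
        2 / q ^ 3 * (7 * K / q ^ 2)) := by gcongr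
    _ = ‖S‖ * ‖GN * S - P‖ + (28 + 10 / q + 14 / q ^ 4) * K / q := by
        field_simp
        ring
    _ ≤ ‖S‖ * ‖GN * S - P‖ + 40 * K / q := by
        have h1 : 10 / (q : ℝ) ≤ 5 := by rw [div_le_iff₀ hq0]; linarith
        have h2 : 14 / (q : ℝ) ^ 4 ≤ 7 := by
          have : (2 : ℝ) ^ 4 ≤ q ^ 4 := pow_le_pow_left₀ (by norm_num) hq2 4
          rw [div_le_iff₀ (by positivity)]; linarith
        gcongr
        linarith

end Truncation

theorem rpow_sq_truncation_le {q b : ℕ} (hb : 1 ≤ b) (hbq : b < q) {ε : ℝ} (hε : 0 < ε)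
    (hε1 : ε ≤ 1 / 2) :
    ((q ^ 12 * (q ^ 12 * q ^ 12) : ℕ) : ℝ) ^ (4 * (ε / 144)) / q ≤ (b : ℝ) ^ (-1 + ε) := by
  have hq0 : (0 : ℝ) < q := by exact_mod_cast (by omega : 0 < q)
  have hb0 : (0 : ℝ) < b := by exact_mod_cast hb
  have h1 : ((q ^ 12 * (q ^ 12 * q ^ 12) : ℕ) : ℝ) = (q : ℝ) ^ 36 := by push_cast; ring
  rw [h1, ← Real.rpow_natCast, ← Real.rpow_mul hq0.le, div_eq_mul_inv, ← Real.rpow_neg_one,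
    ← Real.rpow_add hq0, show ((36 : ℕ) : ℝ) * (4 * (ε / 144)) + -1 = -1 + ε by push_cast; ring]
  exact Real.rpow_le_rpow_of_nonpos hb0 (by exact_mod_cast hbq.le) (by linarith)

theorem exists_mean_square_le {ε : ℝ} (hε : 0 < ε) (hε1 : ε ≤ 1 / 2) :
    ∃ A : ℝ, 0 ≤ A ∧ ∀ q : ℕ, q.Prime → Odd q → ∀ b : ℕ, 1 ≤ b → b < q →
      (1 / q.totient : ℝ) * ∑ k ∈ Finset.range q,
          |Cfun q k + Cq q * ∑ n ∈ Finset.Icc 1 b,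
              bCoef n * saw ((((k : ℤ) * invMod q (2 * n) : ℤ) : ℝ) / q)| ^ 2 ≤
        A * (b : ℝ) ^ (-1 + ε) := by
  set η := ε / 144 with hη
  have hη0 : 0 < η := by positivity
  obtain ⟨D, hD1, hD⟩ := exists_card_divisors_le (show 0 < η / 4 by positivity)
  set K := ∑' n : ℕ, |aCoef n| * (n : ℝ) ^ (1 / 4 : ℝ) with hK
  set Z := ∑' n : ℕ, (n : ℝ) ^ (-1 - η) with hZ
  have hZ0 : 0 ≤ Z := tsum_nonneg fun n => by positivity
  refine ⟨8 * (2 * ((D ^ 4) ^ 2 * (Z + 2 * Z ^ 2)) + 2 * (40 * K) ^ 2), by positivity,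
    fun q hqp hq b hb hbq => ?_⟩
  have : Fact q.Prime := ⟨hqp⟩
  have hq2 : (2 : ℝ) ≤ q := by exact_mod_cast hqp.two_le
  have hb1 : (1 : ℝ) ≤ b := by exact_mod_cast hb
  have hq0 : (0 : ℝ) < q := by linarith
  have hφ : (0 : ℝ) < q.totient := by exact_mod_cast Nat.totient_pos.mpr hqp.pos
  have hqφ : (q : ℝ) / q.totient ≤ 2 := by
    rw [div_le_iff₀ hφ, Nat.totient_prime hqp, Nat.cast_sub hqp.one_le]
    push_cast
    linarith
  obtain ⟨c, hc, hcX⟩ := exists_tail_coefficients (hbq.le.trans (Nat.le_self_pow (by norm_num) q) :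
    b ≤ q ^ 12)
  set M := q ^ 12 * (q ^ 12 * q ^ 12) with hM
  have hcD : ∀ n : ℕ, n ≠ 0 → |c n| ≤ D ^ 4 * (n : ℝ) ^ (-1 + η) := by
    intro n hn
    have hn0 : (0 : ℝ) < n := by exact_mod_cast Nat.pos_of_ne_zero hn
    refine (hc n).trans ?_
    calc (n.divisors.card : ℝ) ^ 4 / n ≤ (D * (n : ℝ) ^ (η / 4)) ^ 4 / n := by
          gcongr
          exact hD n hn
      _ = D ^ 4 * (n : ℝ) ^ (-1 + η) := by
          rw [mul_pow, ← Real.rpow_natCast ((n : ℝ) ^ (η / 4)), ← Real.rpow_mul hn0.le,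
            Real.rpow_add hn0, Real.rpow_neg_one]
          rw [show η / 4 * ((4 : ℕ) : ℝ) = η by push_cast; ring]
          field_simp
  have hbε : (b : ℝ) ^ (-1 + 3 * η) ≤ (b : ℝ) ^ (-1 + ε) :=
    Real.rpow_le_rpow_of_exponent_le hb1 (by rw [hη]; linarith)
  have hqε : 1 / (q : ℝ) ≤ (b : ℝ) ^ (-1 + ε) := by
    calc 1 / (q : ℝ) ≤ 1 / b := one_div_le_one_div_of_le (by linarith) (by exact_mod_cast hbq.le)
      _ = (b : ℝ) ^ (-1 : ℝ) := by rw [Real.rpow_neg_one, one_div]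
      _ ≤ _ := Real.rpow_le_rpow_of_exponent_le hb1 (by linarith)
  have hMε := rpow_sq_truncation_le hb hbq hε hε1
  set R := (b : ℝ) ^ (-1 + ε) with hR
  have hR0 : 0 ≤ R := by positivity
  have hpairs : ∑ χ : DirichletCharacter ℂ q,
      ‖∑ n ∈ Finset.Ioc b M, (c n : ℂ) * χ ((n : ℕ) : ZMod q)‖ ^ 2 ≤
      q.totient * ((D ^ 4) ^ 2 * (Z + 2 * Z ^ 2) * R) := by
    refine (sum_norm_sq_sum_mul_character_le (fun n => (c n : ℂ)) (Finset.Ioc b M)).trans ?_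
    simp only [Complex.norm_real, Real.norm_eq_abs]
    refine mul_le_mul_of_nonneg_left ((sum_sum_filter_congr_le hη0 (by rw [hη]; linarith)
      hqp.one_le hb hcD).trans ?_) hφ.le
    calc _ = (D ^ 4) ^ 2 * (Z * (b : ℝ) ^ (-1 + 3 * η) +
          2 * Z ^ 2 * ((M : ℝ) ^ (4 * η) / q)) := by rw [mul_div_assoc]
      _ ≤ (D ^ 4) ^ 2 * (Z * R + 2 * Z ^ 2 * R) := by gcongr
      _ = _ := by ring
  have hterm : ∀ χ ∈ Finset.univ.filter (fun χ : DirichletCharacter ℂ q => χ ≠ 1),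
      (‖DirichletCharacter.LFunction χ⁻¹ 1‖ * ‖approxError b χ‖) ^ 2 ≤
        2 * ‖∑ n ∈ Finset.Ioc b M, (c n : ℂ) * χ ((n : ℕ) : ZMod q)‖ ^ 2 +
          2 * (40 * K / q) ^ 2 := by
    intro χ hχ
    have h := norm_LFunction_mul_approxError_le (Finset.mem_filter.mp hχ).2 hbq
    rw [hcX (fun n => χ (n : ZMod q)) fun m n => by rw [Nat.cast_mul, map_mul]] at h
    refine (pow_le_pow_left₀ (by positivity) h 2).trans ?_
    rw [← mul_add]
    exact add_sq_le
  have hcard : ((Finset.univ : Finset (DirichletCharacter ℂ q)).card : ℝ) = q.totient := by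
    rw [Finset.card_univ, ← Nat.card_eq_fintype_card,
      DirichletCharacter.card_eq_totient_of_hasEnoughRootsOfUnity]
  refine (mean_square_le hq hbq).trans ?_
  calc _ ≤ 4 * q / (q.totient : ℝ) ^ 2 * ∑ χ : DirichletCharacter ℂ q,
        (2 * ‖∑ n ∈ Finset.Ioc b M, (c n : ℂ) * χ ((n : ℕ) : ZMod q)‖ ^ 2 +
          2 * (40 * K / q) ^ 2) := by
        refine mul_le_mul_of_nonneg_left ((Finset.sum_le_sum hterm).trans
          (Finset.sum_le_sum_of_subset_of_nonneg (Finset.filter_subset _ _)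
            fun _ _ _ => by positivity)) (by positivity)
    _ ≤ 4 * q / (q.totient : ℝ) ^ 2 * (2 * (q.totient * ((D ^ 4) ^ 2 * (Z + 2 * Z ^ 2) * R)) +
          q.totient * (2 * (40 * K) ^ 2 * R)) := by
        rw [Finset.sum_add_distrib, ← Finset.mul_sum, Finset.sum_const, nsmul_eq_mul, hcard]
        have hsq : (40 * K / q) ^ 2 ≤ (40 * K) ^ 2 * R := by
          rw [div_pow, div_eq_mul_inv]
          refine mul_le_mul_of_nonneg_left (le_trans ?_ hqε) (by positivity)
          rw [one_div]
          exact inv_anti₀ hq0 (le_self_pow₀ (by linarith) two_ne_zero)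
        have hsq' : 2 * (40 * K / q) ^ 2 ≤ 2 * (40 * K) ^ 2 * R := by linarith
        gcongr
    _ = q / q.totient * (4 * (2 * ((D ^ 4) ^ 2 * (Z + 2 * Z ^ 2)) + 2 * (40 * K) ^ 2) * R) := by
        field_simp
    _ ≤ 2 * (4 * (2 * ((D ^ 4) ^ 2 * (Z + 2 * Z ^ 2)) + 2 * (40 * K) ^ 2) * R) := by gcongr
    _ = _ := by ring

/-- Mean square approximation of `C(k)` by a short sawtooth sum (Lemma 2.3). -/
theorem C_mean_square_approximation :
    ∀ ε : ℝ, 0 < ε → ∃ A : ℝ, ∀ q : ℕ, q.Prime → Odd q → ∀ B : ℝ, 1 ≤ B → B < q →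
      (1 / q.totient : ℝ) * ∑ k ∈ Finset.range q,
          |Cfun q k + Cq q * ∑ n ∈ Finset.Icc 1 ⌊B⌋₊,
              bCoef n * saw ((((k : ℤ) * invMod q (2 * n) : ℤ) : ℝ) / q)| ^ 2 ≤
        A * B ^ (-1 + ε) := by
  intro ε hε
  obtain ⟨A, hA0, hA⟩ := exists_mean_square_le (lt_min hε one_half_pos) (min_le_right ε (1 / 2))
  refine ⟨A * 2, fun q hqp hq B hB1 hBq => ?_⟩
  have hb : 1 ≤ ⌊B⌋₊ := Nat.le_floor (by exact_mod_cast hB1)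
  have hbq : ⌊B⌋₊ < q := (Nat.floor_lt (by linarith)).mpr hBq
  refine (hA q hqp hq ⌊B⌋₊ hb hbq).trans ?_
  rw [mul_assoc]
  refine mul_le_mul_of_nonneg_left ?_ hA0
  have hb1 : (1 : ℝ) ≤ ⌊B⌋₊ := by exact_mod_cast hb
  have hhalf : B / 2 ≤ ⌊B⌋₊ := by
    have := Nat.lt_floor_add_one B
    linarith
  have hδ : min ε (1 / 2) ≤ 1 / 2 := min_le_right _ _
  have hδ0 : 0 < min ε (1 / 2) := lt_min hε one_half_pos
  calc (⌊B⌋₊ : ℝ) ^ (-1 + min ε (1 / 2)) ≤ (B / 2) ^ (-1 + min ε (1 / 2)) :=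
        Real.rpow_le_rpow_of_nonpos (by linarith) hhalf (by linarith)
    _ = 2 ^ (1 - min ε (1 / 2)) * B ^ (-1 + min ε (1 / 2)) := by
        rw [Real.div_rpow (by linarith) zero_le_two, div_eq_mul_inv, ← Real.rpow_neg zero_le_two,
          mul_comm]
        ring_nf
    _ ≤ 2 ^ (1 : ℝ) * B ^ (-1 + ε) := by
        gcongr
        · norm_num
        · linarith
        · exact min_le_left _ _
    _ = 2 * B ^ (-1 + ε) := by rw [Real.rpow_one]
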